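/- arXiv:1301.5494 — 3 statements merged into one kernel-verified Lean document; each statement's English description precedes it below -/
import Mathlib

section
/- (Characterization of chaotic sequences.) Let p be a Borel probability measure on ℝ^d and, for each N ≥ 1, let P_N be a symmetric Borel probability measure on (ℝ^d)^N. Then the following are equivalent: (a) for each j ≥ 1, the j-particle marginal P_{N:j} converges weakly to p^{⊗j} as N → ∞ (i.e. ∫Φ dP_{N:j} → ∫Φ dp^{⊗j} for all bounded continuous Φ on (ℝ^d)^j); (b) for each bounded continuous φ : ℝ^d → ℝ and each ε > 0, P_N({Z_N ∈ (ℝ^d)^N : |∫φ dμ_{Z_N} − ∫φ dp| ≥ ε}) → 0 as N → ∞. -/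
open MeasureTheory Real Filter Topology
open scoped ENNReal NNReal

noncomputable section

/-- The empirical measure of an `N`-tuple of points in `ℝ^d`. -/
def empiricalMeasure {d N : ℕ} (z : Fin N → EuclideanSpace ℝ (Fin d)) :
    Measure (EuclideanSpace ℝ (Fin d)) :=
  (N : ℝ≥0∞)⁻¹ • ∑ j : Fin N, Measure.dirac (z j)

/-- A measure on `(ℝ^d)^N` is symmetric if it is invariant under every
permutation of the coordinates. -/
def IsSymmetricMeasure {d N : ℕ} (P : Measure (Fin N → EuclideanSpace ℝ (Fin d))) :
    Prop :=
  ∀ σ : Equiv.Perm (Fin N),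
    Measure.map (fun z (i : Fin N) => z (σ i)) P = P

/-- The `j`-particle marginal of a measure on `(ℝ^d)^N`: the image under the
projection on the first `j` coordinates when `j ≤ N`, and `0` by convention when
`j > N`. -/
def marginal {d : ℕ} (N j : ℕ) (P : Measure (Fin N → EuclideanSpace ℝ (Fin d))) :
    Measure (Fin j → EuclideanSpace ℝ (Fin d)) :=
  if h : j ≤ N then
    Measure.map (fun z (i : Fin j) => z (Fin.castLE h i)) P
  else 0

/-- The average of a function over the points of an `N`-tuple. -/
def empiricalAverage {𝕜 X : Type*} [RCLike 𝕜] {N : ℕ} (φ : X → 𝕜) (z : Fin N → X) : 𝕜 :=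
  (N : 𝕜)⁻¹ * ∑ k, φ (z k)

theorem integral_empiricalMeasure {d N : ℕ} (φ : EuclideanSpace ℝ (Fin d) → ℝ)
    (z : Fin N → EuclideanSpace ℝ (Fin d)) :
    ∫ x, φ x ∂(empiricalMeasure z) = empiricalAverage φ z := by
  rw [empiricalMeasure, integral_smul_measure, integral_finsetSum_measure]
  · simp [empiricalAverage]
  · intro i _
    exact integrable_dirac (by simp)

section empiricalAverage

variable {𝕜 X : Type*} [RCLike 𝕜] {N : ℕ}

theorem norm_empiricalAverage_le {φ : X → 𝕜} {C : ℝ} (hC : 0 ≤ C) (hφ : ∀ x, ‖φ x‖ ≤ C)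
    (z : Fin N → X) : ‖empiricalAverage φ z‖ ≤ C := by
  rcases N.eq_zero_or_pos with rfl | hN
  · simpa [empiricalAverage] using hC
  have hN' : (0 : ℝ) < N := by exact_mod_cast hN
  rw [empiricalAverage, norm_mul, norm_inv, RCLike.norm_natCast, inv_mul_le_iff₀ hN']
  calc ‖∑ k, φ (z k)‖ ≤ ∑ k : Fin N, ‖φ (z k)‖ := norm_sum_le _ _
    _ ≤ ∑ _k : Fin N, C := Finset.sum_le_sum fun k _ => hφ _
    _ = N * C := by simp

theorem continuous_empiricalAverage [TopologicalSpace X] {φ : X → 𝕜} (hφ : Continuous φ) :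
    Continuous (empiricalAverage φ : (Fin N → X) → 𝕜) := by
  unfold empiricalAverage
  fun_prop

theorem prod_empiricalAverage {j : ℕ} (φ : Fin j → X → 𝕜) (z : Fin N → X) :
    ∏ i, empiricalAverage (φ i) z =
      ((N : 𝕜) ^ j)⁻¹ * ∑ f : Fin j → Fin N, ∏ i, φ i (z (f i)) := by
  simp [empiricalAverage, Finset.prod_mul_distrib, Finset.prod_univ_sum]

end empiricalAverage

theorem map_comp_eq_marginal {d N j : ℕ} {P : Measure (Fin N → EuclideanSpace ℝ (Fin d))}
    (hP : IsSymmetricMeasure P) {f : Fin j → Fin N} (hf : Function.Injective f) :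
    P.map (fun z (i : Fin j) => z (f i)) = marginal N j P := by
  have hjN : j ≤ N := by simpa using Fintype.card_le_of_injective f hf
  obtain ⟨σ, hσ⟩ := Equiv.Perm.exists_extending_pair (Fin.castLE hjN) f
    (Fin.castLE_injective hjN) hf
  rw [marginal, dif_pos hjN]
  conv_rhs => rw [← hP σ]
  rw [Measure.map_map (by fun_prop) (by fun_prop)]
  congr 1
  ext z i : 2
  simp [hσ]

theorem isProbabilityMeasure_marginal {d N j : ℕ} (hjN : j ≤ N)
    {P : Measure (Fin N → EuclideanSpace ℝ (Fin d))} [IsProbabilityMeasure P] :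
    IsProbabilityMeasure (marginal N j P) := by
  rw [marginal, dif_pos hjN]
  exact Measure.isProbabilityMeasure_map (Measurable.aemeasurable (by fun_prop))

theorem card_filter_injective (j N : ℕ) :
    (Finset.univ.filter fun f : Fin j → Fin N => Function.Injective f).card =
      N.descFactorial j := by
  rw [← Fintype.card_subtype,
    Fintype.card_congr (Equiv.subtypeInjectiveEquivEmbedding (Fin j) (Fin N)),
    Fintype.card_embedding_eq, Fintype.card_fin, Fintype.card_fin]

theorem norm_prod_le_one {𝕜 ι : Type*} [RCLike 𝕜] (s : Finset ι) {a : ι → 𝕜}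
    (ha : ∀ i, ‖a i‖ ≤ 1) : ‖∏ i ∈ s, a i‖ ≤ 1 := by
  rw [norm_prod]
  exact Finset.prod_le_one (fun _ _ => norm_nonneg _) fun i _ => ha i

theorem norm_prod_sub_prod_le_sum {𝕜 ι : Type*} [RCLike 𝕜] (s : Finset ι) {a b : ι → 𝕜}
    (ha : ∀ i, ‖a i‖ ≤ 1) (hb : ∀ i, ‖b i‖ ≤ 1) :
    ‖∏ i ∈ s, a i - ∏ i ∈ s, b i‖ ≤ ∑ i ∈ s, ‖a i - b i‖ := by
  classical
  induction s using Finset.induction_on with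
  | empty => simp
  | insert i s hi ih =>
    rw [Finset.prod_insert hi, Finset.prod_insert hi, Finset.sum_insert hi]
    calc ‖a i * ∏ i ∈ s, a i - b i * ∏ i ∈ s, b i‖
        = ‖(a i - b i) * ∏ i ∈ s, a i + b i * (∏ i ∈ s, a i - ∏ i ∈ s, b i)‖ := by
          congr 1; ring
      _ ≤ ‖a i - b i‖ * ‖∏ i ∈ s, a i‖ + ‖b i‖ * ‖∏ i ∈ s, a i - ∏ i ∈ s, b i‖ := by
          rw [← norm_mul, ← norm_mul]
          exact norm_add_le _ _
      _ ≤ ‖a i - b i‖ * 1 + 1 * ‖∏ i ∈ s, a i - ∏ i ∈ s, b i‖ := by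
          gcongr
          · exact norm_prod_le_one s ha
          · exact hb i
      _ ≤ ‖a i - b i‖ + ∑ i ∈ s, ‖a i - b i‖ := by
          rw [mul_one, one_mul]
          gcongr

theorem Continuous.integrable_of_norm_le {X F : Type*} [TopologicalSpace X] [MeasurableSpace X]
    [OpensMeasurableSpace X] [SecondCountableTopology X] [NormedAddCommGroup F]
    {μ : Measure X} [IsFiniteMeasure μ] {f : X → F} (hf : Continuous f) (C : ℝ)
    (hC : ∀ x, ‖f x‖ ≤ C) : Integrable f μ :=
  Integrable.of_bound hf.stronglyMeasurable.aestronglyMeasurable C (ae_of_all _ hC)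

/-- For a symmetric measure, the expectation of a product of empirical averages differs from the
integral of the tensor product against the marginal only by the contribution of the
non-injective index maps. -/
theorem norm_integral_prod_empiricalAverage_sub_le {𝕜 : Type*} [RCLike 𝕜] {d N j : ℕ}
    (hN : 1 ≤ N) (hjN : j ≤ N) {P : Measure (Fin N → EuclideanSpace ℝ (Fin d))}
    [IsProbabilityMeasure P] (hP : IsSymmetricMeasure P)
    {φ : Fin j → EuclideanSpace ℝ (Fin d) → 𝕜} (hφ : ∀ i, Continuous (φ i))
    (hφ1 : ∀ i x, ‖φ i x‖ ≤ 1) :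
    ‖∫ z, ∏ i, empiricalAverage (φ i) z ∂P - ∫ w, ∏ i, φ i (w i) ∂(marginal N j P)‖ ≤
      2 * (1 - (N.descFactorial j : ℝ) / (N : ℝ) ^ j) := by
  classical
  have := isProbabilityMeasure_marginal hjN (P := P)
  set M := ∫ w, ∏ i, φ i (w i) ∂(marginal N j P) with hM
  have hNj : (0 : ℝ) < (N : ℝ) ^ j := by positivity
  have hNj' : (N : 𝕜) ^ j ≠ 0 := pow_ne_zero _ (by exact_mod_cast (by omega : N ≠ 0))
  have hprod : ∀ (f : Fin j → Fin N) (z : Fin N → EuclideanSpace ℝ (Fin d)),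
      ‖∏ i, φ i (z (f i))‖ ≤ 1 := fun f z => norm_prod_le_one _ fun i => hφ1 i _
  have hint : ∀ f : Fin j → Fin N, Integrable (fun z => ∏ i, φ i (z (f i))) P := fun f =>
    Continuous.integrable_of_norm_le (by fun_prop) 1 (hprod f)
  have hI : ∀ f : Fin j → Fin N, ‖∫ z, ∏ i, φ i (z (f i)) ∂P‖ ≤ 1 := fun f => by
    simpa using norm_integral_le_of_norm_le_const (μ := P) (ae_of_all _ (hprod f))
  have hM1 : ‖M‖ ≤ 1 := by
    simpa using norm_integral_le_of_norm_le_const (μ := marginal N j P)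
      (ae_of_all _ fun w => norm_prod_le_one Finset.univ fun i => hφ1 i (w i))
  have hinj : ∀ f : Fin j → Fin N, Function.Injective f → ∫ z, ∏ i, φ i (z (f i)) ∂P = M := by
    intro f hf
    rw [hM, ← map_comp_eq_marginal hP hf, integral_map (Measurable.aemeasurable (by fun_prop))]
    exact (Continuous.stronglyMeasurable (by fun_prop)).aestronglyMeasurable
  have hterm : ∀ f : Fin j → Fin N, ‖∫ z, ∏ i, φ i (z (f i)) ∂P - M‖ ≤
      2 - if Function.Injective f then 2 else 0 := by
    intro f
    split_ifs with hf
    · simp [hinj f hf]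
    · have := norm_sub_le (∫ z, ∏ i, φ i (z (f i)) ∂P) M
      linarith [hI f]
  have hsum : ∑ f : Fin j → Fin N, ((2 : ℝ) - if Function.Injective f then 2 else 0) =
      2 * ((N : ℝ) ^ j - N.descFactorial j) := by
    rw [Finset.sum_sub_distrib, ← Finset.sum_filter, Finset.sum_const, Finset.sum_const,
      card_filter_injective]
    simp
    ring
  have hdecomp : ∫ z, ∏ i, empiricalAverage (φ i) z ∂P - M =
      ((N : 𝕜) ^ j)⁻¹ * ∑ f : Fin j → Fin N, (∫ z, ∏ i, φ i (z (f i)) ∂P - M) := by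
    simp_rw [prod_empiricalAverage]
    rw [integral_const_mul, integral_finsetSum _ fun f _ => hint f, Finset.sum_sub_distrib,
      mul_sub]
    congr 1
    simp [hNj']
  rw [hdecomp, norm_mul, norm_inv, norm_pow, RCLike.norm_natCast, inv_mul_le_iff₀ hNj]
  calc ‖∑ f : Fin j → Fin N, (∫ z, ∏ i, φ i (z (f i)) ∂P - M)‖
      ≤ ∑ f : Fin j → Fin N, ‖∫ z, ∏ i, φ i (z (f i)) ∂P - M‖ := norm_sum_le _ _
    _ ≤ ∑ f : Fin j → Fin N, ((2 : ℝ) - if Function.Injective f then 2 else 0) :=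
        Finset.sum_le_sum fun f _ => hterm f
    _ = (N : ℝ) ^ j * (2 * (1 - N.descFactorial j / (N : ℝ) ^ j)) := by
        rw [hsum]
        field_simp

theorem tendsto_descFactorial_div_pow (j : ℕ) :
    Tendsto (fun N : ℕ => (N.descFactorial j : ℝ) / (N : ℝ) ^ j) atTop (𝓝 1) := by
  refine (Asymptotics.isEquivalent_iff_tendsto_one ?_).1 (isEquivalent_descFactorial j)
  filter_upwards [eventually_ge_atTop 1] with N hN
  positivity

/-- Along a sequence of symmetric probability measures, the expectation of a product of empirical
averages is asymptotically the integral of the tensor product against the marginal. -/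
theorem tendsto_integral_prod_empiricalAverage_sub {𝕜 : Type*} [RCLike 𝕜] {d j : ℕ}
    {P : (N : ℕ) → Measure (Fin N → EuclideanSpace ℝ (Fin d))}
    (hPprob : ∀ N : ℕ, 1 ≤ N → IsProbabilityMeasure (P N))
    (hPsym : ∀ N : ℕ, 1 ≤ N → IsSymmetricMeasure (P N))
    {φ : Fin j → EuclideanSpace ℝ (Fin d) → 𝕜} (hφ : ∀ i, Continuous (φ i))
    (hφ1 : ∀ i x, ‖φ i x‖ ≤ 1) :
    Tendsto (fun N : ℕ => ∫ z, ∏ i, empiricalAverage (φ i) z ∂(P N) -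
      ∫ w, ∏ i, φ i (w i) ∂(marginal N j (P N))) atTop (𝓝 0) := by
  have hlim : Tendsto (fun N : ℕ => 2 * (1 - (N.descFactorial j : ℝ) / (N : ℝ) ^ j))
      atTop (𝓝 0) := by
    simpa using ((tendsto_descFactorial_div_pow j).const_sub 1).const_mul 2
  refine squeeze_zero_norm' ?_ hlim
  filter_upwards [eventually_ge_atTop 1, eventually_ge_atTop j] with N hN hjN
  have := hPprob N hN
  exact norm_integral_prod_empiricalAverage_sub_le hN hjN (hPsym N hN) hφ hφ1

/-- Uniformly bounded functions converging to zero in probability converge to zero in mean. -/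
theorem tendsto_integral_abs_of_tendsto_measure {Ω : ℕ → Type*} [∀ N, MeasurableSpace (Ω N)]
    {P : (N : ℕ) → Measure (Ω N)} (hP : ∀ N, 1 ≤ N → IsProbabilityMeasure (P N))
    {f : (N : ℕ) → Ω N → ℝ} (hf : ∀ N, Measurable (f N)) {K : ℝ}
    (hfK : ∀ N z, |f N z| ≤ K)
    (h : ∀ ε : ℝ, 0 < ε → Tendsto (fun N => P N {z | ε ≤ |f N z|}) atTop (𝓝 0)) :
    Tendsto (fun N => ∫ z, |f N z| ∂(P N)) atTop (𝓝 0) := by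
  rw [Metric.tendsto_atTop']
  intro ε hε
  have hreal : Tendsto (fun N => K * (P N).real {z | ε / 2 ≤ |f N z|}) atTop (𝓝 0) := by
    have := (ENNReal.tendsto_toReal ENNReal.zero_ne_top).comp (h (ε / 2) (half_pos hε))
    simpa [Measure.real, Function.comp_def] using this.const_mul K
  obtain ⟨N₀, hN₀⟩ := eventually_atTop.1 (hreal.eventually_lt_const (half_pos hε))
  refine ⟨N₀, fun N hN => ?_⟩
  have := hP N (by omega)
  have hms : MeasurableSet {z | ε / 2 ≤ |f N z|} :=
    measurableSet_le measurable_const (hf N).abs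
  have hbound : ∫ z, |f N z| ∂(P N) ≤
      ∫ z, (ε / 2 + {z | ε / 2 ≤ |f N z|}.indicator (fun _ => K) z) ∂(P N) := by
    refine integral_mono
      (Integrable.of_bound (hf N).abs.aestronglyMeasurable K (ae_of_all _ fun z => by
        simpa using hfK N z))
      ((integrable_const _).add ((integrable_const K).indicator hms)) fun z => ?_
    by_cases hz : ε / 2 ≤ |f N z|
    · simp only [Set.indicator, Set.mem_ofPred_eq, hz, if_true]
      linarith [hfK N z]
    · simp only [Set.indicator, Set.mem_ofPred_eq, hz, if_false]
      linarith
  rw [integral_add (integrable_const _) ((integrable_const K).indicator hms),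
    integral_indicator_const _ hms] at hbound
  simp only [integral_const, probReal_univ, smul_eq_mul, one_mul] at hbound
  rw [Real.dist_eq, sub_zero, abs_of_nonneg (integral_nonneg fun z => abs_nonneg _)]
  linarith [hN₀ N hN.le, mul_comm K ((P N).real {z | ε / 2 ≤ |f N z|})]

theorem empiricalAverage_sub_const {X : Type*} {N : ℕ} (hN : 1 ≤ N) (φ : X → ℝ) (a : ℝ)
    (z : Fin N → X) :
    empiricalAverage (fun x => φ x - a) z = empiricalAverage φ z - a := by
  have hN' : (N : ℝ) ≠ 0 := by exact_mod_cast (by omega : N ≠ 0)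
  simp [empiricalAverage, Finset.sum_sub_distrib, mul_sub, hN']

theorem empiricalAverage_div_const {X : Type*} {N : ℕ} (φ : X → ℝ) (a : ℝ)
    (z : Fin N → X) :
    empiricalAverage (fun x => φ x / a) z = empiricalAverage φ z / a := by
  simp [empiricalAverage, ← Finset.sum_div, mul_div_assoc]

/-- Convergence of the two-particle marginals forces convergence of the empirical measures in
probability. -/
theorem tendsto_measure_empiricalMeasure_of_tendsto_marginal {d : ℕ}
    {p : Measure (EuclideanSpace ℝ (Fin d))} [IsProbabilityMeasure p]
    {P : (N : ℕ) → Measure (Fin N → EuclideanSpace ℝ (Fin d))}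
    (hPprob : ∀ N : ℕ, 1 ≤ N → IsProbabilityMeasure (P N))
    (hPsym : ∀ N : ℕ, 1 ≤ N → IsSymmetricMeasure (P N))
    (h : ∀ Φ : (Fin 2 → EuclideanSpace ℝ (Fin d)) → ℝ, Continuous Φ →
      (∃ C : ℝ, ∀ w, |Φ w| ≤ C) →
      Tendsto (fun N : ℕ => ∫ w, Φ w ∂(marginal N 2 (P N))) atTop
        (𝓝 (∫ w, Φ w ∂(Measure.pi (fun _ : Fin 2 => p)))))
    {φ : EuclideanSpace ℝ (Fin d) → ℝ} (hφ : Continuous φ) {C : ℝ} (hC : ∀ z, |φ z| ≤ C)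
    {ε : ℝ} (hε : 0 < ε) :
    Tendsto (fun N : ℕ => P N {Z : Fin N → EuclideanSpace ℝ (Fin d) |
      ε ≤ |(∫ z, φ z ∂(empiricalMeasure Z)) - ∫ z, φ z ∂p|}) atTop (𝓝 0) := by
  set a := ∫ z, φ z ∂p with ha
  have hC0 : 0 ≤ C := (abs_nonneg _).trans (hC 0)
  have haC : |a| ≤ C := by
    simpa using norm_integral_le_of_norm_le_const (μ := p)
      (ae_of_all _ fun x => (Real.norm_eq_abs _).trans_le (hC x))
  set K : ℝ := 2 * C + 1
  have hK : 0 < K := by positivity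
  set ψ : EuclideanSpace ℝ (Fin d) → ℝ := fun x => (φ x - a) / K with hψ
  have hψc : Continuous ψ := by fun_prop
  have hψ1 : ∀ x, ‖ψ x‖ ≤ 1 := fun x => by
    rw [Real.norm_eq_abs, abs_div, abs_of_pos hK, div_le_one hK]
    have := abs_sub (φ x) a
    have := hC x
    simp only [K]
    linarith
  have hψ0 : ∫ x, ψ x ∂p = 0 := by
    rw [integral_div, integral_sub (hφ.integrable_of_norm_le C hC) (integrable_const _)]
    simp [ha]
  have hmarg := h (fun w => ∏ i, ψ (w i)) (by fun_prop)
    ⟨1, fun w => norm_prod_le_one _ fun i => hψ1 _⟩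
  rw [integral_fintype_prod_eq_prod (fun _ : Fin 2 => ψ)] at hmarg
  have hsq : Tendsto (fun N : ℕ => ∫ z, (empiricalAverage ψ z) ^ 2 ∂(P N)) atTop (𝓝 0) := by
    have := (tendsto_integral_prod_empiricalAverage_sub hPprob hPsym
      (φ := fun _ : Fin 2 => ψ) (fun _ => hψc) fun _ => hψ1).add hmarg
    simpa [hψ0] using this
  have hbound : Tendsto (fun N : ℕ => ENNReal.ofReal
      (((ε / K) ^ 2)⁻¹ * ∫ z, (empiricalAverage ψ z) ^ 2 ∂(P N))) atTop (𝓝 0) := by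
    simpa using ENNReal.tendsto_ofReal (hsq.const_mul ((ε / K) ^ 2)⁻¹)
  refine tendsto_of_tendsto_of_tendsto_of_le_of_le' tendsto_const_nhds hbound
    (Eventually.of_forall fun _ => zero_le) ?_
  filter_upwards [eventually_ge_atTop 1] with N hN
  have := hPprob N hN
  have hset : {Z : Fin N → EuclideanSpace ℝ (Fin d) |
      ε ≤ |(∫ z, φ z ∂(empiricalMeasure Z)) - a|} ⊆
      {Z | (ε / K) ^ 2 ≤ (empiricalAverage ψ Z) ^ 2} := by
    intro Z hZ
    simp only [Set.mem_ofPred_eq, integral_empiricalMeasure] at hZ ⊢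
    rw [hψ, empiricalAverage_div_const, empiricalAverage_sub_const hN, div_pow, div_pow,
      ← sq_abs (empiricalAverage φ Z - a)]
    gcongr
  refine (measure_mono hset).trans ?_
  rw [ENNReal.le_ofReal_iff_toReal_le (measure_ne_top _ _) (by positivity), ← Measure.real,
    le_inv_mul_iff₀ (by positivity)]
  refine mul_meas_ge_le_integral_of_nonneg (ae_of_all _ fun z => sq_nonneg _)
    (((continuous_empiricalAverage hψc).pow 2).integrable_of_norm_le 1 fun z => ?_) _
  rw [Pi.pow_apply, norm_pow]
  exact pow_le_one₀ (norm_nonneg _) (norm_empiricalAverage_le zero_le_one hψ1 z)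

theorem re_empiricalAverage {X : Type*} {N : ℕ} (φ : X → ℂ) (z : Fin N → X) :
    (empiricalAverage φ z).re = empiricalAverage (fun x => (φ x).re) z := by
  simp [empiricalAverage, ← Complex.ofReal_natCast, ← Complex.ofReal_inv]

theorem im_empiricalAverage {X : Type*} {N : ℕ} (φ : X → ℂ) (z : Fin N → X) :
    (empiricalAverage φ z).im = empiricalAverage (fun x => (φ x).im) z := by
  simp [empiricalAverage, ← Complex.ofReal_natCast, ← Complex.ofReal_inv]

section Converse

variable {d : ℕ} {p : Measure (EuclideanSpace ℝ (Fin d))} [IsProbabilityMeasure p]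
  {P : (N : ℕ) → Measure (Fin N → EuclideanSpace ℝ (Fin d))}

theorem tendsto_integral_abs_empiricalAverage_sub
    (hPprob : ∀ N : ℕ, 1 ≤ N → IsProbabilityMeasure (P N))
    (h : ∀ φ : EuclideanSpace ℝ (Fin d) → ℝ, Continuous φ → (∃ C : ℝ, ∀ z, |φ z| ≤ C) →
      ∀ ε : ℝ, 0 < ε → Tendsto (fun N : ℕ => P N {Z : Fin N → EuclideanSpace ℝ (Fin d) |
        ε ≤ |(∫ z, φ z ∂(empiricalMeasure Z)) - ∫ z, φ z ∂p|}) atTop (𝓝 0))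
    {φ : EuclideanSpace ℝ (Fin d) → ℝ} (hφ : Continuous φ) {C : ℝ} (hC : ∀ z, |φ z| ≤ C) :
    Tendsto (fun N : ℕ => ∫ z, |empiricalAverage φ z - ∫ x, φ x ∂p| ∂(P N)) atTop (𝓝 0) := by
  have hC0 : 0 ≤ C := (abs_nonneg _).trans (hC 0)
  have haC : |∫ x, φ x ∂p| ≤ C := by
    simpa using norm_integral_le_of_norm_le_const (μ := p)
      (ae_of_all _ fun x => (Real.norm_eq_abs _).trans_le (hC x))
  refine tendsto_integral_abs_of_tendsto_measure hPprob
    (fun N => ((continuous_empiricalAverage hφ).sub continuous_const).measurable)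
    (K := C + C) (fun N z => ?_) fun ε hε => ?_
  · have hle : ‖empiricalAverage φ z‖ ≤ C := norm_empiricalAverage_le hC0 hC z
    exact (abs_sub _ _).trans (add_le_add hle haC)
  · simpa only [integral_empiricalMeasure] using h φ hφ ⟨C, hC⟩ ε hε

theorem tendsto_integral_norm_empiricalAverage_sub
    (hPprob : ∀ N : ℕ, 1 ≤ N → IsProbabilityMeasure (P N))
    (h : ∀ φ : EuclideanSpace ℝ (Fin d) → ℝ, Continuous φ → (∃ C : ℝ, ∀ z, |φ z| ≤ C) →
      ∀ ε : ℝ, 0 < ε → Tendsto (fun N : ℕ => P N {Z : Fin N → EuclideanSpace ℝ (Fin d) |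
        ε ≤ |(∫ z, φ z ∂(empiricalMeasure Z)) - ∫ z, φ z ∂p|}) atTop (𝓝 0))
    {φ : EuclideanSpace ℝ (Fin d) → ℂ} (hφ : Continuous φ) {C : ℝ} (hC : ∀ z, ‖φ z‖ ≤ C) :
    Tendsto (fun N : ℕ => ∫ z, ‖empiricalAverage φ z - ∫ x, φ x ∂p‖ ∂(P N)) atTop (𝓝 0) := by
  have hC0 : 0 ≤ C := (norm_nonneg _).trans (hC 0)
  have hrec : Continuous fun x => (φ x).re := Complex.continuous_re.comp hφ
  have himc : Continuous fun x => (φ x).im := Complex.continuous_im.comp hφ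
  have hreC : ∀ x, |(φ x).re| ≤ C := fun x => (Complex.abs_re_le_norm _).trans (hC x)
  have himC : ∀ x, |(φ x).im| ≤ C := fun x => (Complex.abs_im_le_norm _).trans (hC x)
  have hlim := (tendsto_integral_abs_empiricalAverage_sub hPprob h hrec hreC).add
    (tendsto_integral_abs_empiricalAverage_sub hPprob h himc himC)
  rw [add_zero] at hlim
  have hint : Integrable φ p := hφ.integrable_of_norm_le C hC
  have hre : (∫ x, φ x ∂p).re = ∫ x, (φ x).re ∂p := (integral_re hint).symm
  have him : (∫ x, φ x ∂p).im = ∫ x, (φ x).im ∂p := (integral_im hint).symm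
  refine squeeze_zero' (Eventually.of_forall fun N => integral_nonneg fun z => norm_nonneg _)
    ?_ hlim
  filter_upwards [eventually_ge_atTop 1] with N hN
  have := hPprob N hN
  have hint' : ∀ {𝕜 : Type} [RCLike 𝕜] {f : EuclideanSpace ℝ (Fin d) → 𝕜} (a : 𝕜),
      Continuous f → (∀ x, ‖f x‖ ≤ C) →
      Integrable (fun z => ‖empiricalAverage f z - a‖) (P N) := fun a hf hfC =>
    (((continuous_empiricalAverage hf).integrable_of_norm_le C
      (norm_empiricalAverage_le hC0 hfC)).sub (integrable_const a)).norm
  have hint1 := hint' (∫ x, (φ x).re ∂p) hrec hreC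
  have hint2 := hint' (∫ x, (φ x).im ∂p) himc himC
  simp only [Real.norm_eq_abs] at hint1 hint2
  rw [← integral_add hint1 hint2]
  refine integral_mono (hint' _ hφ hC) (hint1.add hint2) fun z => ?_
  refine (Complex.norm_le_abs_re_add_abs_im _).trans_eq ?_
  simp [re_empiricalAverage, im_empiricalAverage, hre, him]

/-- If the empirical measures converge in probability, integrals of tensor products against
the marginals converge. -/
theorem tendsto_integral_prod_marginal
    (hPprob : ∀ N : ℕ, 1 ≤ N → IsProbabilityMeasure (P N))
    (hPsym : ∀ N : ℕ, 1 ≤ N → IsSymmetricMeasure (P N))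
    (h : ∀ φ : EuclideanSpace ℝ (Fin d) → ℝ, Continuous φ → (∃ C : ℝ, ∀ z, |φ z| ≤ C) →
      ∀ ε : ℝ, 0 < ε → Tendsto (fun N : ℕ => P N {Z : Fin N → EuclideanSpace ℝ (Fin d) |
        ε ≤ |(∫ z, φ z ∂(empiricalMeasure Z)) - ∫ z, φ z ∂p|}) atTop (𝓝 0))
    {j : ℕ} {φ : Fin j → EuclideanSpace ℝ (Fin d) → ℂ} (hφ : ∀ i, Continuous (φ i))
    (hφ1 : ∀ i x, ‖φ i x‖ ≤ 1) :
    Tendsto (fun N : ℕ => ∫ w, ∏ i, φ i (w i) ∂(marginal N j (P N))) atTop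
      (𝓝 (∏ i, ∫ x, φ i x ∂p)) := by
  have hlim : Tendsto (fun N : ℕ =>
      ∑ i, ∫ z, ‖empiricalAverage (φ i) z - ∫ x, φ i x ∂p‖ ∂(P N)) atTop (𝓝 0) := by
    simpa using tendsto_finsetSum (Finset.univ : Finset (Fin j)) fun i _ =>
      tendsto_integral_norm_empiricalAverage_sub hPprob h (hφ i) (hφ1 i)
  have havg : Tendsto (fun N : ℕ =>
      ∫ z, ∏ i, empiricalAverage (φ i) z ∂(P N) - ∏ i, ∫ x, φ i x ∂p) atTop (𝓝 0) := by
    refine squeeze_zero_norm' ?_ hlim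
    filter_upwards [eventually_ge_atTop 1] with N hN
    have := hPprob N hN
    have hle : ∀ i (z : Fin N → EuclideanSpace ℝ (Fin d)), ‖empiricalAverage (φ i) z‖ ≤ 1 :=
      fun i z => norm_empiricalAverage_le zero_le_one (hφ1 i) z
    have hcont : ∀ i, Continuous fun z : Fin N → EuclideanSpace ℝ (Fin d) =>
      empiricalAverage (φ i) z := fun i => continuous_empiricalAverage (hφ i)
    have hmean : ∀ i, ‖∫ x, φ i x ∂p‖ ≤ 1 := fun i => by
      simpa using norm_integral_le_of_norm_le_const (μ := p) (ae_of_all _ (hφ1 i))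
    have hint : Integrable (fun z => ∏ i, empiricalAverage (φ i) z) (P N) :=
      Continuous.integrable_of_norm_le (by fun_prop) 1 fun z =>
        norm_prod_le_one _ fun i => hle i z
    have hint' : ∀ i, Integrable (fun z => ‖empiricalAverage (φ i) z - ∫ x, φ i x ∂p‖) (P N) :=
      fun i => (((hcont i).integrable_of_norm_le 1 (hle i)).sub (integrable_const _)).norm
    have heq : ∫ z, ∏ i, empiricalAverage (φ i) z ∂(P N) - ∏ i, ∫ x, φ i x ∂p =
        ∫ z, (∏ i, empiricalAverage (φ i) z - ∏ i, ∫ x, φ i x ∂p) ∂(P N) := by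
      rw [integral_sub hint (integrable_const _)]
      simp
    rw [heq, ← integral_finsetSum _ fun i _ => hint' i]
    refine (norm_integral_le_integral_norm _).trans (integral_mono
      (hint.sub (integrable_const _)).norm (integrable_finsetSum _ fun i _ => hint' i)
      fun z => ?_)
    exact norm_prod_sub_prod_le_sum _ (fun i => hle i z) hmean
  have := (havg.sub
    (tendsto_integral_prod_empiricalAverage_sub hPprob hPsym hφ hφ1)).add_const
    (∏ i, ∫ x, φ i x ∂p)
  simpa using this

/-- Convergence in probability of the empirical measures forces weak convergence of every
marginal to the corresponding tensor power. -/
theorem tendsto_integral_marginal_of_tendsto_measure_empiricalMeasure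
    (hPprob : ∀ N : ℕ, 1 ≤ N → IsProbabilityMeasure (P N))
    (hPsym : ∀ N : ℕ, 1 ≤ N → IsSymmetricMeasure (P N))
    (h : ∀ φ : EuclideanSpace ℝ (Fin d) → ℝ, Continuous φ → (∃ C : ℝ, ∀ z, |φ z| ≤ C) →
      ∀ ε : ℝ, 0 < ε → Tendsto (fun N : ℕ => P N {Z : Fin N → EuclideanSpace ℝ (Fin d) |
        ε ≤ |(∫ z, φ z ∂(empiricalMeasure Z)) - ∫ z, φ z ∂p|}) atTop (𝓝 0))
    {j : ℕ} (hj : 1 ≤ j) {Φ : (Fin j → EuclideanSpace ℝ (Fin d)) → ℝ} (hΦ : Continuous Φ)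
    {C : ℝ} (hC : ∀ w, |Φ w| ≤ C) :
    Tendsto (fun N : ℕ => ∫ w, Φ w ∂(marginal N j (P N))) atTop
      (𝓝 (∫ w, Φ w ∂(Measure.pi (fun _ : Fin j => p)))) := by
  let e := MeasurableEquiv.toLp 2 (Fin j → EuclideanSpace ℝ (Fin d))
  rw [← tendsto_add_atTop_iff_nat j]
  have hprob : ∀ N, IsProbabilityMeasure (marginal (N + j) j (P (N + j))) := fun N => by
    have := hPprob (N + j) (by omega)
    exact isProbabilityMeasure_marginal (by omega)
  let μ : ℕ → ProbabilityMeasure (PiLp 2 fun _ : Fin j => EuclideanSpace ℝ (Fin d)) := fun N =>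
    ⟨(marginal (N + j) j (P (N + j))).map e,
      Measure.isProbabilityMeasure_map e.measurable.aemeasurable⟩
  let μ₀ : ProbabilityMeasure (PiLp 2 fun _ : Fin j => EuclideanSpace ℝ (Fin d)) :=
    ⟨(Measure.pi fun _ : Fin j => p).map e,
      Measure.isProbabilityMeasure_map e.measurable.aemeasurable⟩
  have hμ : Tendsto μ atTop (𝓝 μ₀) := by
    refine ProbabilityMeasure.tendsto_of_tendsto_charFun fun t => ?_
    have hpi : charFun (μ₀ : Measure (PiLp 2 fun _ : Fin j => EuclideanSpace ℝ (Fin d))) t =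
        ∏ i, charFun p (t i) := charFun_pi t
    have hμN : ∀ N, charFun (μ N : Measure (PiLp 2 fun _ : Fin j => EuclideanSpace ℝ (Fin d))) t =
        ∫ w, ∏ i, Complex.exp (inner ℝ (w i) (t i) * Complex.I)
          ∂(marginal (N + j) j (P (N + j))) := fun N => by
      change charFun ((marginal (N + j) j (P (N + j))).map e) t = _
      simp_rw [charFun, integral_map_equiv, PiLp.inner_apply]
      simp [e, Complex.ofReal_sum, Finset.sum_mul, Complex.exp_sum]
    simp_rw [hpi, hμN, charFun]
    exact (tendsto_add_atTop_iff_nat j).2 (tendsto_integral_prod_marginal hPprob hPsym h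
      (φ := fun i x => Complex.exp (inner ℝ x (t i) * Complex.I))
      (fun i => by fun_prop) fun i x => (Complex.norm_exp_ofReal_mul_I _).le)
  have he : Continuous e.symm :=
    PiLp.continuous_ofLp 2 fun _ : Fin j => EuclideanSpace ℝ (Fin d)
  let g : BoundedContinuousFunction (PiLp 2 fun _ : Fin j => EuclideanSpace ℝ (Fin d)) ℝ :=
    BoundedContinuousFunction.ofNormedAddCommGroup
      (fun x => Φ (e.symm x)) (hΦ.comp he) C fun x => hC _
  have hg := ProbabilityMeasure.tendsto_iff_forall_integral_tendsto.1 hμ g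
  have hmap : ∀ ν : Measure (Fin j → EuclideanSpace ℝ (Fin d)),
      ∫ x, g x ∂(ν.map e) = ∫ w, Φ w ∂ν := fun ν => by
    rw [integral_map_equiv]
    rfl
  change Tendsto (fun N => ∫ x, g x ∂((marginal (N + j) j (P (N + j))).map e)) atTop
    (𝓝 (∫ x, g x ∂((Measure.pi fun _ : Fin j => p).map e))) at hg
  simpa only [hmap] using hg

end Converse

/-- characterization of chaotic sequences: for symmetric probability
measures `P_N` on `(ℝ^d)^N` and a probability measure `p` on `ℝ^d`, the sequence
`(P_N)` is `p`-chaotic, i.e. `P_{N:j} → p^{⊗j}` weakly for every `j ≥ 1`, if and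
only if for every bounded continuous `φ` and every `ε > 0`,
`P_N({Z_N : |⟨μ_{Z_N} − p, φ⟩| ≥ ε}) → 0` as `N → ∞`. -/
theorem stmt9 (d : ℕ)
    (p : Measure (EuclideanSpace ℝ (Fin d))) [IsProbabilityMeasure p]
    (P : (N : ℕ) → Measure (Fin N → EuclideanSpace ℝ (Fin d)))
    (hPprob : ∀ N : ℕ, 1 ≤ N → IsProbabilityMeasure (P N))
    (hPsym : ∀ N : ℕ, 1 ≤ N → IsSymmetricMeasure (P N)) :
    (∀ j : ℕ, 1 ≤ j →
      ∀ Φ : (Fin j → EuclideanSpace ℝ (Fin d)) → ℝ, Continuous Φ →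
        (∃ C : ℝ, ∀ w, |Φ w| ≤ C) →
        Tendsto (fun N : ℕ => ∫ w, Φ w ∂(marginal N j (P N))) atTop
          (𝓝 (∫ w, Φ w ∂(Measure.pi (fun _ : Fin j => p))))) ↔
    (∀ φ : EuclideanSpace ℝ (Fin d) → ℝ, Continuous φ → (∃ C : ℝ, ∀ z, |φ z| ≤ C) →
      ∀ ε : ℝ, 0 < ε →
        Tendsto (fun N : ℕ =>
            P N {Z : Fin N → EuclideanSpace ℝ (Fin d) |
              ε ≤ |(∫ z, φ z ∂(empiricalMeasure Z)) - ∫ z, φ z ∂p|})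
          atTop (𝓝 0)) := by
  refine ⟨fun h φ hφ ⟨C, hC⟩ ε hε => ?_, fun h j hj Φ hΦ ⟨C, hC⟩ => ?_⟩
  · exact tendsto_measure_empiricalMeasure_of_tendsto_marginal hPprob hPsym
      (h 2 one_le_two) hφ hC hε
  · exact tendsto_integral_marginal_of_tendsto_measure_empiricalMeasure hPprob hPsym h hj hΦ hC
end
end

section
/- (Horowitz-Karandikar quantitative law of large numbers.) For every Borel probability measure p on ℝ^d with a := ∫_{ℝ^d} |z|^{d+5} p(dz) < ∞, there exists a positive constant C(a,d), depending only on a and on the dimension d, such that for every N ≥ 1, ∫_{(ℝ^d)^N} dist_{MK,2}(μ_{Z_N}, p)² p^{⊗N}(dZ_N) ≤ C(a,d)² / N^{2/(d+4)}. -/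
open MeasureTheory Real Filter Topology
open scoped ENNReal NNReal

noncomputable section

/-- The set of couplings of two Borel measures on `ℝ^d`. -/
def couplings {d : ℕ} (μ ν : Measure (EuclideanSpace ℝ (Fin d))) :
    Set (Measure (EuclideanSpace ℝ (Fin d) × EuclideanSpace ℝ (Fin d))) :=
  {γ | γ.map Prod.fst = μ ∧ γ.map Prod.snd = ν}

/-- The square of the Monge-Kantorovich distance with exponent 2 (with values in
`ℝ≥0∞`): `dist_{MK,2}(μ,ν)² = inf_{π ∈ Π(μ,ν)} ∬ |x−y|² π(dx dy)`. -/
def distMK2sq {d : ℕ} (μ ν : Measure (EuclideanSpace ℝ (Fin d))) : ℝ≥0∞ :=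
  ⨅ γ ∈ couplings μ ν, ∫⁻ p, edist p.1 p.2 ^ 2 ∂γ

/-- Two finite measures of equal total mass admit a coupling. -/
lemma exists_measure_with_marginals {X : Type*} [MeasurableSpace X] (α β : Measure X)
    [IsFiniteMeasure α] [IsFiniteMeasure β] (h : α Set.univ = β Set.univ) :
    ∃ γ : Measure (X × X), γ.map Prod.fst = α ∧ γ.map Prod.snd = β := by
  by_cases h0 : α Set.univ = 0
  · have hβ : β = 0 := Measure.measure_univ_eq_zero.1 (h ▸ h0)
    have hα : α = 0 := Measure.measure_univ_eq_zero.1 h0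
    exact ⟨0, by simp [hα], by simp [hβ]⟩
  · have hc : (α Set.univ)⁻¹ * α Set.univ = 1 :=
      ENNReal.inv_mul_cancel h0 (measure_ne_top _ _)
    refine ⟨(α Set.univ)⁻¹ • α.prod β, ?_, ?_⟩
    · rw [Measure.map_smul, Measure.map_fst_prod, ← h, smul_smul, hc, one_smul]
    · rw [Measure.map_smul, Measure.map_snd_prod, smul_smul, hc, one_smul]

/-- Relative to a countable partition, a finite measure splits into pieces of mass
`min (μ (Q k)) (n k)` carried by the cells `Q k`, and a remainder of mass `μ (Q k) - n k`
on each cell. -/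
lemma exists_split_of_partition {X ι : Type*} [MeasurableSpace X] [MeasurableSpace ι]
    [Countable ι] [MeasurableSingletonClass ι] (μ : Measure X) [IsFiniteMeasure μ]
    (κ : X → ι) (hκ : Measurable κ) (n : ι → ℝ≥0∞) :
    ∃ (A B : ι → Measure X), μ = Measure.sum A + Measure.sum B ∧
      (∀ k, A k Set.univ = min (μ (κ ⁻¹' {k})) (n k)) ∧
      (∀ k, B k Set.univ = μ (κ ⁻¹' {k}) - n k) ∧
      (∀ k, ∀ᵐ x ∂A k, κ x = k) ∧ (∀ k, ∀ᵐ x ∂B k, κ x = k) := by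
  have hQ : ∀ k, MeasurableSet (κ ⁻¹' {k}) := fun k => hκ (measurableSet_singleton k)
  have hae : ∀ k, ∀ᵐ x ∂μ.restrict (κ ⁻¹' {k}), κ x = k := fun k => ae_restrict_mem (hQ k)
  have hmul : ∀ k, ∀ c ≤ μ (κ ⁻¹' {k}), c / μ (κ ⁻¹' {k}) * μ (κ ⁻¹' {k}) = c := by
    intro k c hc
    refine ENNReal.div_mul_cancel' (fun h => ?_) (fun h => absurd h (measure_ne_top _ _))
    simpa [h] using hc
  refine ⟨fun k => (min (μ (κ ⁻¹' {k})) (n k) / μ (κ ⁻¹' {k})) • μ.restrict (κ ⁻¹' {k}),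
    fun k => ((μ (κ ⁻¹' {k}) - n k) / μ (κ ⁻¹' {k})) • μ.restrict (κ ⁻¹' {k}), ?_, ?_, ?_, ?_, ?_⟩
  · have h1 : μ = Measure.sum fun k => μ.restrict (κ ⁻¹' {k}) := by
      rw [← Measure.restrict_iUnion _ hQ]
      · rw [← Set.preimage_iUnion, Set.iUnion_of_singleton, Set.preimage_univ,
          Measure.restrict_univ]
      · intro i j hij
        exact Disjoint.preimage κ (by simpa using hij)
    rw [Measure.sum_add_sum]
    conv_lhs => rw [h1]
    congr 1
    ext1 k
    by_cases h0 : μ (κ ⁻¹' {k}) = 0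
    · simp [Measure.restrict_eq_zero.2 h0]
    · rw [← add_smul, ← ENNReal.add_div, add_comm, tsub_add_min,
        ENNReal.div_self h0 (measure_ne_top _ _), one_smul]
  · intro k
    simpa using hmul k _ (min_le_left _ _)
  · intro k
    simpa using hmul k _ tsub_le_self
  · intro k
    exact Measure.ae_smul_measure (hae k) _
  · intro k
    exact Measure.ae_smul_measure (hae k) _

/-- If the cells of a countable partition have diameter at most `D` and norms bounded by `R`, the
squared Monge-Kantorovich distance is controlled by the masses of the cells. -/
lemma distMK2sq_le_of_partition {d : ℕ} {ι : Type*} [MeasurableSpace ι] [Countable ι]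
    [MeasurableSingletonClass ι] (μ ν : Measure (EuclideanSpace ℝ (Fin d)))
    [IsProbabilityMeasure μ] [IsProbabilityMeasure ν]
    (κ : EuclideanSpace ℝ (Fin d) → ι) (hκ : Measurable κ) (D : ℝ≥0∞) (R : ι → ℝ≥0∞)
    (hD : ∀ x y, κ x = κ y → edist x y ≤ D) (hR : ∀ x, ‖x‖ₑ ≤ R (κ x)) :
    distMK2sq μ ν ≤ D ^ 2 + 2 * ∑' k, R k ^ 2 *
      ((μ (κ ⁻¹' {k}) - ν (κ ⁻¹' {k})) + (ν (κ ⁻¹' {k}) - μ (κ ⁻¹' {k}))) := by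
  obtain ⟨A, B, hμ, hA, hB, hAs, hBs⟩ :=
    exists_split_of_partition μ κ hκ (fun k => ν (κ ⁻¹' {k}))
  obtain ⟨A', B', hν, hA', hB', hAs', hBs'⟩ :=
    exists_split_of_partition ν κ hκ (fun k => μ (κ ⁻¹' {k}))
  have hAfin : ∀ k, IsFiniteMeasure (A k) := fun k =>
    ⟨by rw [hA]; exact (min_le_left _ _).trans_lt (measure_lt_top _ _)⟩
  have hAfin' : ∀ k, IsFiniteMeasure (A' k) := fun k =>
    ⟨by rw [hA']; exact (min_le_left _ _).trans_lt (measure_lt_top _ _)⟩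
  have eμ : Measure.sum A Set.univ + Measure.sum B Set.univ = 1 := by
    rw [← Measure.add_apply, ← hμ, measure_univ]
  have eν : Measure.sum A' Set.univ + Measure.sum B' Set.univ = 1 := by
    rw [← Measure.add_apply, ← hν, measure_univ]
  have eA : ∀ k, A k Set.univ = A' k Set.univ := fun k => by rw [hA, hA', min_comm]
  have eAs : Measure.sum A Set.univ = Measure.sum A' Set.univ := by
    simp [Measure.sum_apply, eA]
  have hA1 : Measure.sum A Set.univ ≤ 1 := eμ ▸ le_self_add
  have hA1' : Measure.sum A Set.univ ≠ ∞ := ne_top_of_le_ne_top ENNReal.one_ne_top hA1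
  have hBfin : IsFiniteMeasure (Measure.sum B) :=
    ⟨lt_of_le_of_lt (eμ ▸ le_add_self) ENNReal.one_lt_top⟩
  have hBfin' : IsFiniteMeasure (Measure.sum B') :=
    ⟨lt_of_le_of_lt (eν ▸ le_add_self) ENNReal.one_lt_top⟩
  have eB : Measure.sum B Set.univ = Measure.sum B' Set.univ := by
    rw [← eν, ← eAs] at eμ
    exact (ENNReal.add_right_inj hA1').1 eμ
  choose γ hγ1 hγ2 using fun k => exists_measure_with_marginals (A k) (A' k) (eA k)
  obtain ⟨γ', hγ1', hγ2'⟩ := exists_measure_with_marginals _ _ eB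
  have hcpl : Measure.sum γ + γ' ∈ couplings μ ν := by
    constructor
    · rw [Measure.map_add _ _ measurable_fst, Measure.map_sum measurable_fst.aemeasurable, hγ1',
        hμ]
      simp only [hγ1]
    · rw [Measure.map_add _ _ measurable_snd, Measure.map_sum measurable_snd.aemeasurable, hγ2',
        hν]
      simp only [hγ2]
  refine (iInf₂_le _ hcpl).trans ?_
  rw [lintegral_add_measure, lintegral_sum_measure]
  refine add_le_add ?_ ?_
  · have h1 : ∀ k, ∫⁻ p, edist p.1 p.2 ^ 2 ∂γ k ≤ D ^ 2 * A k Set.univ := by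
      intro k
      have hm : γ k Set.univ = A k Set.univ := by
        rw [← hγ1 k, Measure.map_apply measurable_fst MeasurableSet.univ, Set.preimage_univ]
      rw [← hm, ← lintegral_const]
      have a1 : ∀ᵐ p ∂γ k, κ p.1 = k :=
        ae_of_ae_map measurable_fst.aemeasurable (p := fun x => κ x = k) (by rw [hγ1]; exact hAs k)
      have a2 : ∀ᵐ p ∂γ k, κ p.2 = k :=
        ae_of_ae_map measurable_snd.aemeasurable (p := fun x => κ x = k) (by rw [hγ2]; exact hAs' k)
      refine lintegral_mono_ae ?_
      filter_upwards [a1, a2] with p h1 h2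
      gcongr
      exact hD _ _ (h1.trans h2.symm)
    calc ∑' k, ∫⁻ p, edist p.1 p.2 ^ 2 ∂γ k ≤ ∑' k, D ^ 2 * A k Set.univ :=
          ENNReal.tsum_le_tsum h1
      _ = D ^ 2 * Measure.sum A Set.univ := by
          rw [ENNReal.tsum_mul_left, Measure.sum_apply _ MeasurableSet.univ]
      _ ≤ D ^ 2 * 1 := by gcongr
      _ = D ^ 2 := mul_one _
  · have hb : ∀ (n : ι → ℝ≥0∞) (B : ι → Measure (EuclideanSpace ℝ (Fin d))),
        (∀ k, B k Set.univ = n k) → (∀ k, ∀ᵐ x ∂B k, κ x = k) →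
        ∫⁻ x, ‖x‖ₑ ^ 2 ∂(Measure.sum B) ≤ ∑' k, R k ^ 2 * n k := by
      intro n B hB hs
      rw [lintegral_sum_measure]
      refine ENNReal.tsum_le_tsum fun k => ?_
      rw [← hB, ← lintegral_const]
      refine lintegral_mono_ae ?_
      filter_upwards [hs k] with x hx
      gcongr
      exact hx ▸ hR x
    have hpt : ∀ p : EuclideanSpace ℝ (Fin d) × EuclideanSpace ℝ (Fin d),
        edist p.1 p.2 ^ 2 ≤ 2 * (‖p.1‖ₑ ^ 2 + ‖p.2‖ₑ ^ 2) := by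
      intro p
      have h1 : edist p.1 p.2 ≤ ‖p.1‖ₑ + ‖p.2‖ₑ := by
        rw [edist_eq_enorm_sub]; exact enorm_sub_le
      refine (pow_le_pow_left' h1 2).trans ?_
      have := ENNReal.rpow_add_le_mul_rpow_add_rpow ‖p.1‖ₑ ‖p.2‖ₑ (p := 2) (by norm_num)
      norm_num at this
      exact_mod_cast this
    calc ∫⁻ p, edist p.1 p.2 ^ 2 ∂γ' ≤ ∫⁻ p, 2 * (‖p.1‖ₑ ^ 2 + ‖p.2‖ₑ ^ 2) ∂γ' :=
          lintegral_mono hpt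
      _ = 2 * (∫⁻ x, ‖x‖ₑ ^ 2 ∂(Measure.sum B) + ∫⁻ x, ‖x‖ₑ ^ 2 ∂(Measure.sum B')) := by
          rw [lintegral_const_mul _ (by fun_prop), lintegral_add_left (by fun_prop), ← hγ1',
            ← hγ2', lintegral_map (by fun_prop) measurable_fst,
            lintegral_map (by fun_prop) measurable_snd]
      _ ≤ _ := by
          simp_rw [mul_add]
          rw [ENNReal.tsum_add, mul_add]
          gcongr
          · exact hb _ _ hB hBs
          · exact hb _ _ hB' hBs'

lemma isProbabilityMeasure_empiricalMeasure {d N : ℕ} (hN : 1 ≤ N)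
    (Z : Fin N → EuclideanSpace ℝ (Fin d)) : IsProbabilityMeasure (empiricalMeasure Z) := by
  refine ⟨?_⟩
  simp only [empiricalMeasure, Measure.smul_apply, Measure.finsetSum_apply, measure_univ,
    Finset.sum_const, Finset.card_univ, Fintype.card_fin, smul_eq_mul, nsmul_eq_mul, mul_one]
  exact ENNReal.inv_mul_cancel (by simp; omega) (by simp)

lemma toReal_empiricalMeasure_apply {d N : ℕ} (Z : Fin N → EuclideanSpace ℝ (Fin d))
    {Q : Set (EuclideanSpace ℝ (Fin d))} (hQ : MeasurableSet Q) :
    (empiricalMeasure Z Q).toReal = (N : ℝ)⁻¹ * ∑ j, Q.indicator (fun _ => (1 : ℝ)) (Z j) := by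
  simp only [empiricalMeasure, Measure.smul_apply, Measure.finsetSum_apply, smul_eq_mul,
    ENNReal.toReal_mul, ENNReal.toReal_inv, ENNReal.toReal_natCast, Measure.dirac_apply' _ hQ]
  rw [ENNReal.toReal_sum (by intro i _; by_cases h : Z i ∈ Q <;> simp [h])]
  congr 1
  refine Finset.sum_congr rfl fun i _ => ?_
  by_cases h : Z i ∈ Q <;> simp [h]

/-- The mean square deviation of the empirical frequency of a set is at most `p Q / N`. -/
lemma lintegral_sq_empiricalMeasure_sub_le {d N : ℕ} (hN : 1 ≤ N)
    (p : Measure (EuclideanSpace ℝ (Fin d))) [IsProbabilityMeasure p]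
    {Q : Set (EuclideanSpace ℝ (Fin d))} (hQ : MeasurableSet Q) :
    ∫⁻ Z, ENNReal.ofReal (((empiricalMeasure Z Q).toReal - (p Q).toReal) ^ 2)
      ∂(Measure.pi (fun _ : Fin N => p)) ≤ ENNReal.ofReal ((p Q).toReal / N) := by
  have hN0 : (0 : ℝ) < N := by exact_mod_cast hN
  set X : EuclideanSpace ℝ (Fin d) → ℝ := Q.indicator fun _ => (1 : ℝ) with hX
  have hXm : MemLp X 2 p := (memLp_const (1 : ℝ)).indicator hQ
  have hXi : ∫ x, X x ∂p = (p Q).toReal := by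
    simp [hX, integral_indicator hQ, Measure.real]
  have hmemi : ∀ j : Fin N, MemLp (fun Z : Fin N → EuclideanSpace ℝ (Fin d) => X (Z j)) 2
      (Measure.pi (fun _ : Fin N => p)) := fun j =>
    hXm.comp_measurePreserving (measurePreserving_eval (fun _ : Fin N => p) j)
  set Y : (Fin N → EuclideanSpace ℝ (Fin d)) → ℝ := ∑ j, fun Z => X (Z j) with hY
  have hYm : MemLp Y 2 (Measure.pi (fun _ : Fin N => p)) := memLp_finsetSum' _ fun j _ => hmemi j
  have hYi : ∫ Z, Y Z ∂(Measure.pi (fun _ : Fin N => p)) = N * (p Q).toReal := by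
    simp only [hY, Finset.sum_apply]
    rw [integral_finsetSum _ fun j _ => (hmemi j).integrable (by norm_num)]
    have : ∀ j : Fin N, ∫ Z, X (Z j) ∂(Measure.pi (fun _ : Fin N => p)) = (p Q).toReal := by
      intro j
      have := integral_map (μ := Measure.pi (fun _ : Fin N => p)) (f := X)
        (measurable_pi_apply j).aemeasurable (measurable_const.indicator hQ).aestronglyMeasurable
      rw [(measurePreserving_eval (fun _ : Fin N => p) j).map_eq] at this
      rw [← hXi, this]
    simp [this]
  have hV : ProbabilityTheory.variance Y (Measure.pi (fun _ : Fin N => p))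
      ≤ N * (p Q).toReal := by
    rw [hY, ProbabilityTheory.variance_sum_pi (X := fun _ => X) (fun _ => hXm)]
    have : ProbabilityTheory.variance X p ≤ (p Q).toReal := by
      refine (ProbabilityTheory.variance_le_expectation_sq hXm.1).trans (le_of_eq ?_)
      rw [← hXi]
      refine integral_congr_ae (ae_of_all _ fun x => ?_)
      by_cases h : x ∈ Q <;> simp [hX, h]
    simpa using mul_le_mul_of_nonneg_left this hN0.le
  have key : ∀ Z : Fin N → EuclideanSpace ℝ (Fin d),
      ENNReal.ofReal (((empiricalMeasure Z Q).toReal - (p Q).toReal) ^ 2) =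
      ENNReal.ofReal ((N : ℝ)⁻¹ ^ 2) * ENNReal.ofReal
        ((Y Z - ∫ Z, Y Z ∂(Measure.pi (fun _ : Fin N => p))) ^ 2) := by
    intro Z
    rw [← ENNReal.ofReal_mul (by positivity), hYi, toReal_empiricalMeasure_apply Z hQ]
    congr 1
    simp only [hY, Finset.sum_apply]
    field_simp
    rfl
  simp_rw [key]
  rw [lintegral_const_mul' _ _ ENNReal.ofReal_ne_top,
    ← ProbabilityTheory.evariance_eq_lintegral_ofReal, ← ProbabilityTheory.ofReal_variance hYm,
    ← ENNReal.ofReal_mul (by positivity)]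
  apply ENNReal.ofReal_le_ofReal
  calc (N : ℝ)⁻¹ ^ 2 * _ ≤ (N : ℝ)⁻¹ ^ 2 * (N * (p Q).toReal) := by gcongr
    _ = _ := by field_simp

/-- Expectation of the Monge-Kantorovich distance to the empirical measure, bounded through a
countable partition into cells of diameter at most `D` and norms bounded by `R`. -/
lemma lintegral_distMK2sq_le_of_partition {d N : ℕ} (hN : 1 ≤ N) {ι : Type*} [MeasurableSpace ι]
    [Countable ι] [MeasurableSingletonClass ι] (p : Measure (EuclideanSpace ℝ (Fin d)))
    [IsProbabilityMeasure p] (κ : EuclideanSpace ℝ (Fin d) → ι) (hκ : Measurable κ)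
    (D : ℝ≥0∞) (R : ι → ℝ) (hR0 : ∀ k, 0 ≤ R k)
    (hD : ∀ x y, κ x = κ y → edist x y ≤ D) (hR : ∀ x, ‖x‖ ≤ R (κ x)) {t : ℝ} (ht : 0 < t) :
    ∫⁻ Z, distMK2sq (empiricalMeasure Z) p ∂(Measure.pi (fun _ : Fin N => p)) ≤
      D ^ 2 + 2 * (ENNReal.ofReal (t / N) * ∫⁻ x, ENNReal.ofReal ((1 + R (κ x)) ^ (d + 5)) ∂p +
        ENNReal.ofReal t⁻¹ * ∑' k, ENNReal.ofReal (((1 + R k) ^ (d + 1))⁻¹)) := by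
  have hQ : ∀ k, MeasurableSet (κ ⁻¹' {k}) := fun k => hκ (measurableSet_singleton k)
  have hN0 : (0 : ℝ) < N := by exact_mod_cast hN
  set Δ : (Fin N → EuclideanSpace ℝ (Fin d)) → ι → ℝ := fun Z k =>
    (empiricalMeasure Z (κ ⁻¹' {k})).toReal - (p (κ ⁻¹' {k})).toReal with hΔ
  have hΔm : ∀ k, Measurable fun Z => Δ Z k := by
    intro k
    simp only [hΔ, toReal_empiricalMeasure_apply _ (hQ k)]
    refine Measurable.sub_const (Measurable.const_mul (Finset.measurable_sum _ fun j _ => ?_) _) _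
    exact (measurable_const.indicator (hQ k)).comp (measurable_pi_apply j)
  have hcell : ∀ Z k, ENNReal.ofReal (R k) ^ 2 *
      ((empiricalMeasure Z (κ ⁻¹' {k}) - p (κ ⁻¹' {k})) +
        (p (κ ⁻¹' {k}) - empiricalMeasure Z (κ ⁻¹' {k}))) ≤
      ENNReal.ofReal (t * (1 + R k) ^ (d + 5)) * ENNReal.ofReal (Δ Z k ^ 2) +
        ENNReal.ofReal t⁻¹ * ENNReal.ofReal (((1 + R k) ^ (d + 1))⁻¹) := by
    intro Z k
    have := isProbabilityMeasure_empiricalMeasure hN Z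
    have hR1 := hR0 k
    have habs : (empiricalMeasure Z (κ ⁻¹' {k}) - p (κ ⁻¹' {k})) +
        (p (κ ⁻¹' {k}) - empiricalMeasure Z (κ ⁻¹' {k})) = ENNReal.ofReal |Δ Z k| := by
      simp only [hΔ]
      have h1 := ENNReal.ofReal_toReal (measure_ne_top (empiricalMeasure Z) (κ ⁻¹' {k}))
      have h2 := ENNReal.ofReal_toReal (measure_ne_top p (κ ⁻¹' {k}))
      conv_lhs => rw [← h1, ← h2]
      rw [← ENNReal.ofReal_sub _ ENNReal.toReal_nonneg,
        ← ENNReal.ofReal_sub _ ENNReal.toReal_nonneg]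
      generalize (empiricalMeasure Z (κ ⁻¹' {k})).toReal = u
      generalize (p (κ ⁻¹' {k})).toReal = v
      rcases le_total u v with h | h
      · rw [abs_of_nonpos (by linarith), ENNReal.ofReal_of_nonpos (p := u - v) (by linarith)]
        simp
      · rw [abs_of_nonneg (by linarith), ENNReal.ofReal_of_nonpos (p := v - u) (by linarith)]
        simp
    rw [habs, ← ENNReal.ofReal_pow hR1, ← ENNReal.ofReal_mul (by positivity),
      ← ENNReal.ofReal_mul (by positivity), ← ENNReal.ofReal_mul (by positivity),
      ← ENNReal.ofReal_add (by positivity) (by positivity)]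
    apply ENNReal.ofReal_le_ofReal
    have hs : 0 < t * (1 + R k) ^ (d + 1) := by positivity
    have hamgm : ∀ s y : ℝ, 0 < s → y ≤ s * y ^ 2 + s⁻¹ := by
      intro s y hs
      have h1 : s * y ^ 2 + s⁻¹ - y = s⁻¹ * ((s * y - 1 / 2) ^ 2 + 3 / 4) := by
        field_simp; ring
      have : 0 ≤ s⁻¹ * ((s * y - 1 / 2) ^ 2 + 3 / 4) := by positivity
      linarith
    calc R k ^ 2 * |Δ Z k| ≤ t * (1 + R k) ^ (d + 1) * (R k ^ 2 * |Δ Z k|) ^ 2 +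
          (t * (1 + R k) ^ (d + 1))⁻¹ := hamgm _ _ hs
      _ = t * ((1 + R k) ^ (d + 1) * R k ^ 4) * Δ Z k ^ 2 +
          t⁻¹ * ((1 + R k) ^ (d + 1))⁻¹ := by
          rw [mul_pow, sq_abs, mul_inv]; ring
      _ ≤ t * ((1 + R k) ^ (d + 1) * (1 + R k) ^ 4) * Δ Z k ^ 2 +
          t⁻¹ * ((1 + R k) ^ (d + 1))⁻¹ := by
          gcongr
          linarith
      _ = _ := by ring
  have hpt : ∀ Z, distMK2sq (empiricalMeasure Z) p ≤ D ^ 2 + 2 * ∑' k,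
      (ENNReal.ofReal (t * (1 + R k) ^ (d + 5)) * ENNReal.ofReal (Δ Z k ^ 2) +
        ENNReal.ofReal t⁻¹ * ENNReal.ofReal (((1 + R k) ^ (d + 1))⁻¹)) := by
    intro Z
    have := isProbabilityMeasure_empiricalMeasure hN Z
    refine (distMK2sq_le_of_partition (empiricalMeasure Z) p κ hκ D
      (fun k => ENNReal.ofReal (R k)) hD fun x => ?_).trans ?_
    · rw [← ofReal_norm]
      exact ENNReal.ofReal_le_ofReal (hR x)
    · gcongr with k
      exact hcell Z k
  refine (lintegral_mono hpt).trans ?_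
  have hmeas : ∀ k, Measurable fun Z => ENNReal.ofReal (t * (1 + R k) ^ (d + 5)) *
      ENNReal.ofReal (Δ Z k ^ 2) + ENNReal.ofReal t⁻¹ *
        ENNReal.ofReal (((1 + R k) ^ (d + 1))⁻¹) := fun k =>
    (((hΔm k).pow_const 2).ennreal_ofReal.const_mul _).add_const _
  rw [lintegral_add_left measurable_const, lintegral_const, measure_univ, mul_one,
    lintegral_const_mul _ (Measurable.tsum hmeas),
    lintegral_tsum fun k => (hmeas k).aemeasurable]
  have hcells : ∫⁻ x, ENNReal.ofReal ((1 + R (κ x)) ^ (d + 5)) ∂p =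
      ∑' k, ENNReal.ofReal ((1 + R k) ^ (d + 5)) * p (κ ⁻¹' {k}) := by
    rw [← lintegral_map (f := fun k => ENNReal.ofReal ((1 + R k) ^ (d + 5)))
      (measurable_of_countable _) hκ, lintegral_countable']
    simp_rw [Measure.map_apply hκ (measurableSet_singleton _)]
  rw [hcells, ← ENNReal.tsum_mul_left (a := ENNReal.ofReal (t / N)),
    ← ENNReal.tsum_mul_left (a := ENNReal.ofReal t⁻¹), ← ENNReal.tsum_add]
  gcongr with k
  rw [lintegral_add_right _ measurable_const, lintegral_const, measure_univ, mul_one]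
  gcongr
  have hR1 := hR0 k
  rw [lintegral_const_mul _ ((hΔm k).pow_const 2).ennreal_ofReal]
  calc _ ≤ ENNReal.ofReal (t * (1 + R k) ^ (d + 5)) *
        ENNReal.ofReal ((p (κ ⁻¹' {k})).toReal / N) := by
        gcongr
        exact lintegral_sq_empiricalMeasure_sub_le hN p (hQ k)
    _ = _ := by
        conv_rhs => rw [← ENNReal.ofReal_toReal (measure_ne_top p (κ ⁻¹' {k}))]
        rw [← ENNReal.ofReal_mul (by positivity), ← ENNReal.ofReal_mul (by positivity),
          ← ENNReal.ofReal_mul (by positivity)]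
        congr 1
        ring

/-- The index of the cube of side `h` of the lattice `h ℤ^d` containing a point. -/
def cubeIndex {d : ℕ} (h : ℝ) (x : EuclideanSpace ℝ (Fin d)) : Fin d → ℤ :=
  fun i => ⌊x i / h⌋

/-- The lower corner of the cube of side `h` with a given index. -/
def cubeCorner {d : ℕ} (h : ℝ) (k : Fin d → ℤ) : EuclideanSpace ℝ (Fin d) :=
  WithLp.toLp 2 fun i => h * k i

lemma measurable_cubeIndex {d : ℕ} (h : ℝ) : Measurable (cubeIndex (d := d) h) := by
  refine measurable_pi_iff.2 fun i => Int.measurable_floor.comp ?_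
  fun_prop

lemma cubeIndex_eq_iff {d : ℕ} {h : ℝ} (hh : 0 < h) (x : EuclideanSpace ℝ (Fin d))
    (k : Fin d → ℤ) : cubeIndex h x = k ↔ ∀ i, h * k i ≤ x i ∧ x i < h * k i + h := by
  rw [funext_iff]
  refine forall_congr' fun i => ?_
  rw [cubeIndex, Int.floor_eq_iff, le_div_iff₀ hh, div_lt_iff₀ hh, add_mul, one_mul, mul_comm]

lemma cubeIndex_cubeCorner {d : ℕ} {h : ℝ} (hh : 0 < h) (k : Fin d → ℤ) :
    cubeIndex h (cubeCorner h k) = k := by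
  rw [cubeIndex_eq_iff hh]
  intro i
  simp [cubeCorner, hh]

lemma dist_le_of_cubeIndex_eq {d : ℕ} {h : ℝ} (hh : 0 < h) {x y : EuclideanSpace ℝ (Fin d)}
    (hxy : cubeIndex h x = cubeIndex h y) : dist x y ≤ √d * h := by
  have hx := (cubeIndex_eq_iff hh x _).1 hxy
  have hy := (cubeIndex_eq_iff hh y _).1 rfl
  rw [EuclideanSpace.dist_eq]
  calc √(∑ i, dist (x i) (y i) ^ 2) ≤ √(∑ _i : Fin d, h ^ 2) := by
        gcongr with i
        rw [Real.dist_eq, abs_le]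
        constructor <;> linarith [hx i, hy i]
    _ = √d * h := by
        simp [Real.sqrt_sq hh.le]

lemma volume_cubeIndex_preimage {d : ℕ} {h : ℝ} (hh : 0 < h) (k : Fin d → ℤ) :
    volume (cubeIndex (d := d) h ⁻¹' {k}) = ENNReal.ofReal (h ^ d) := by
  have hset : cubeIndex (d := d) h ⁻¹' {k} =
      (MeasurableEquiv.toLp 2 (Fin d → ℝ)).symm ⁻¹'
        (Set.univ.pi fun i => Set.Ico (h * (k i : ℝ)) (h * k i + h)) := by
    ext x
    simp only [Set.mem_preimage, Set.mem_singleton_iff, cubeIndex_eq_iff hh, Set.mem_univ_pi,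
      Set.mem_Ico]
    rfl
  rw [hset, (EuclideanSpace.volume_preserving_symm_measurableEquiv_toLp
    (Fin d)).measure_preimage_equiv, Real.volume_pi_Ico]
  simp [ENNReal.ofReal_pow hh.le]

/-- An upper bound for the norm on the cube of side `h` with a given index. -/
def cubeRadius {d : ℕ} (h : ℝ) (k : Fin d → ℤ) : ℝ := ‖cubeCorner h k‖ + √d * h

lemma norm_le_cubeRadius {d : ℕ} {h : ℝ} (hh : 0 < h) (x : EuclideanSpace ℝ (Fin d)) :
    ‖x‖ ≤ cubeRadius h (cubeIndex h x) := by
  have h1 := dist_le_of_cubeIndex_eq hh (cubeIndex_cubeCorner hh (cubeIndex h x)).symm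
  rw [dist_eq_norm] at h1
  have h2 := norm_le_norm_add_norm_sub' x (cubeCorner h (cubeIndex h x))
  rw [cubeRadius]
  linarith

lemma cubeRadius_le {d : ℕ} {h : ℝ} (hh : 0 < h) (hh1 : h ≤ 1) (x : EuclideanSpace ℝ (Fin d)) :
    cubeRadius h (cubeIndex h x) ≤ ‖x‖ + 2 * √d := by
  have h1 := dist_le_of_cubeIndex_eq hh (cubeIndex_cubeCorner hh (cubeIndex h x))
  rw [dist_eq_norm] at h1
  have h2 := norm_le_norm_add_norm_sub' (cubeCorner h (cubeIndex h x)) x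
  have h3 : √d * h ≤ √d := mul_le_of_le_one_right (Real.sqrt_nonneg _) hh1
  rw [cubeRadius]
  linarith

lemma tsum_inv_one_add_cubeRadius_le {d : ℕ} {h : ℝ} (hh : 0 < h) :
    ∑' k : Fin d → ℤ, ENNReal.ofReal (((1 + cubeRadius h k) ^ (d + 1))⁻¹) ≤
      ENNReal.ofReal ((h ^ d)⁻¹) *
        ∫⁻ x : EuclideanSpace ℝ (Fin d), ENNReal.ofReal (((1 + ‖x‖) ^ (d + 1))⁻¹) := by
  have hQ : ∀ k, MeasurableSet (cubeIndex (d := d) h ⁻¹' {k}) := fun k =>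
    measurable_cubeIndex h (measurableSet_singleton k)
  have hcell : ∀ k : Fin d → ℤ, ENNReal.ofReal (((1 + cubeRadius h k) ^ (d + 1))⁻¹) ≤
      ENNReal.ofReal ((h ^ d)⁻¹) * ∫⁻ x in cubeIndex (d := d) h ⁻¹' {k},
        ENNReal.ofReal (((1 + ‖x‖) ^ (d + 1))⁻¹) := by
    intro k
    have hc : ∫⁻ _ in cubeIndex (d := d) h ⁻¹' {k},
        ENNReal.ofReal (((1 + cubeRadius h k) ^ (d + 1))⁻¹) ≤
        ∫⁻ x in cubeIndex (d := d) h ⁻¹' {k}, ENNReal.ofReal (((1 + ‖x‖) ^ (d + 1))⁻¹) := by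
      refine setLIntegral_mono' (hQ k) fun x hx => ?_
      have hx' : cubeIndex h x = k := hx
      have := norm_le_cubeRadius hh x
      rw [hx'] at this
      gcongr
    rw [setLIntegral_const, volume_cubeIndex_preimage hh] at hc
    refine le_trans (le_of_eq ?_) (mul_le_mul_right hc _)
    rw [mul_left_comm, ← ENNReal.ofReal_mul (by positivity), inv_mul_cancel₀ (by positivity)]
    simp
  refine (ENNReal.tsum_le_tsum hcell).trans (le_of_eq ?_)
  rw [ENNReal.tsum_mul_left, ← lintegral_iUnion hQ]
  · rw [← Set.preimage_iUnion, Set.iUnion_of_singleton, Set.preimage_univ, Measure.restrict_univ]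
  · intro i j hij
    exact Disjoint.preimage _ (by simpa using hij)

lemma lintegral_inv_one_add_norm_pow_lt_top (d : ℕ) :
    ∫⁻ x : EuclideanSpace ℝ (Fin d), ENNReal.ofReal (((1 + ‖x‖) ^ (d + 1))⁻¹) < ∞ := by
  have h := finite_integral_one_add_norm (E := EuclideanSpace ℝ (Fin d)) (μ := volume)
    (r := ((d + 1 : ℕ) : ℝ)) (by simp)
  refine lt_of_le_of_lt (le_of_eq (lintegral_congr fun x => ?_)) h
  rw [Real.rpow_neg (by positivity), Real.rpow_natCast]

lemma lintegral_one_add_cubeRadius_pow_le {d : ℕ} {h : ℝ} (hh : 0 < h) (hh1 : h ≤ 1) (n : ℕ)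
    (p : Measure (EuclideanSpace ℝ (Fin d))) [IsProbabilityMeasure p] :
    ∫⁻ x, ENNReal.ofReal ((1 + cubeRadius h (cubeIndex h x)) ^ n) ∂p ≤
      ENNReal.ofReal (2 ^ (n - 1)) *
        (ENNReal.ofReal ((1 + 2 * √d) ^ n) + ∫⁻ x, (‖x‖₊ : ℝ≥0∞) ^ n ∂p) := by
  have hpt : ∀ x : EuclideanSpace ℝ (Fin d),
      ENNReal.ofReal ((1 + cubeRadius h (cubeIndex h x)) ^ n) ≤
      ENNReal.ofReal (2 ^ (n - 1)) *
        (ENNReal.ofReal ((1 + 2 * √d) ^ n) + (‖x‖₊ : ℝ≥0∞) ^ n) := by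
    intro x
    have h0 : (‖x‖₊ : ℝ≥0∞) = ENNReal.ofReal ‖x‖ := by
      rw [ofReal_norm]; rfl
    rw [h0, ← ENNReal.ofReal_pow (norm_nonneg x),
      ← ENNReal.ofReal_add (by positivity) (by positivity), ← ENNReal.ofReal_mul (by positivity)]
    apply ENNReal.ofReal_le_ofReal
    have h1 := cubeRadius_le hh hh1 x
    have h2 := (norm_nonneg x).trans (norm_le_cubeRadius hh x)
    calc _ ≤ ((1 + 2 * √d) + ‖x‖) ^ n := by
          gcongr ?_ ^ n
          linarith
      _ ≤ _ := add_pow_le (by positivity) (by positivity) n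
  refine (lintegral_mono hpt).trans (le_of_eq ?_)
  rw [lintegral_const_mul _ (by fun_prop), lintegral_add_left measurable_const, lintegral_const,
    measure_univ, mul_one]

/-- Horowitz-Karandikar: for every Borel probability measure `p`
on `ℝ^d` whose moment of order `d+5` equals `a`, there is a constant `C(a,d) > 0`
depending only on `a` and `d` such that
`∫ dist_{MK,2}(μ_{Z_N}, p)² dp^{⊗N}(Z_N) ≤ C(a,d)²/N^{2/(d+4)}` for all `N ≥ 1`. -/
theorem stmt15 (d : ℕ) (a : ℝ) :
    ∃ C : ℝ, 0 < C ∧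
      ∀ p : Measure (EuclideanSpace ℝ (Fin d)), IsProbabilityMeasure p →
        (∫⁻ z, (‖z‖₊ : ℝ≥0∞) ^ (d + 5) ∂p) = ENNReal.ofReal a →
        ∀ N : ℕ, 1 ≤ N →
          (∫⁻ Z, distMK2sq (empiricalMeasure Z) p
              ∂(Measure.pi (fun _ : Fin N => p))) ≤
            ENNReal.ofReal (C ^ 2 / (N : ℝ) ^ ((2 : ℝ) / (d + 4))) := by
  set I : ℝ≥0∞ := ∫⁻ x : EuclideanSpace ℝ (Fin d), ENNReal.ofReal (((1 + ‖x‖) ^ (d + 1))⁻¹)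
    with hI
  have hIr : ENNReal.ofReal I.toReal = I :=
    ENNReal.ofReal_toReal (lintegral_inv_one_add_norm_pow_lt_top d).ne
  set K : ℝ := I.toReal
  have hK0 : 0 ≤ K := ENNReal.toReal_nonneg
  set M : ℝ := 2 ^ (d + 5 - 1) * ((1 + 2 * √d) ^ (d + 5) + max a 0) with hM
  have hM0 : 0 < M := by positivity
  have hS : 0 < d + 2 * (M + K) := by positivity
  refine ⟨√(d + 2 * (M + K)), Real.sqrt_pos.2 hS, ?_⟩
  intro p hp ha N hN
  have hN1 : (1 : ℝ) ≤ N := by exact_mod_cast hN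
  have hN0 : (0 : ℝ) < N := by linarith
  set h : ℝ := (N : ℝ) ^ (-(1 / ((d : ℝ) + 4))) with hh
  have h0 : 0 < h := Real.rpow_pos_of_pos hN0 _
  have h1 : h ≤ 1 := Real.rpow_le_one_of_one_le_of_nonpos hN1 (by
    have : 0 < 1 / ((d : ℝ) + 4) := by positivity
    linarith)
  have hpowN : (N : ℝ) * h ^ (d + 4) = 1 := by
    rw [hh, ← Real.rpow_natCast, ← Real.rpow_mul hN0.le]
    have : -(1 / ((d : ℝ) + 4)) * ((d + 4 : ℕ) : ℝ) = -1 := by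
      push_cast; field_simp
    rw [this, Real.rpow_neg_one, mul_inv_cancel₀ hN0.ne']
  have hpow2 : h ^ 2 = ((N : ℝ) ^ ((2 : ℝ) / (d + 4)))⁻¹ := by
    rw [hh, ← Real.rpow_natCast, ← Real.rpow_mul hN0.le, ← Real.rpow_neg hN0.le]
    congr 1
    push_cast
    ring
  have ht : 0 < (h ^ (d + 2))⁻¹ := by positivity
  have main := lintegral_distMK2sq_le_of_partition hN p (cubeIndex h) (measurable_cubeIndex h)
    (ENNReal.ofReal (√d * h)) (cubeRadius h)
    (fun k => add_nonneg (norm_nonneg _) (by positivity))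
    (fun x y hxy => by
      rw [edist_dist]
      exact ENNReal.ofReal_le_ofReal (dist_le_of_cubeIndex_eq h0 hxy))
    (norm_le_cubeRadius h0) ht
  refine main.trans ?_
  have hmom : ∫⁻ x, ENNReal.ofReal ((1 + cubeRadius h (cubeIndex h x)) ^ (d + 5)) ∂p ≤
      ENNReal.ofReal M := by
    refine (lintegral_one_add_cubeRadius_pow_le h0 h1 (d + 5) p).trans (le_of_eq ?_)
    rw [ha, hM, ENNReal.ofReal_mul (by positivity), ENNReal.ofReal_add (by positivity)
      (le_max_right _ _)]
    congr 2
    rcases le_total a 0 with h | h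
    · rw [max_eq_right h, ENNReal.ofReal_of_nonpos h, ENNReal.ofReal_zero]
    · rw [max_eq_left h]
  have hlat := tsum_inv_one_add_cubeRadius_le (d := d) h0
  rw [← hI, ← hIr] at hlat
  calc _ ≤ ENNReal.ofReal (√d * h) ^ 2 +
        2 * (ENNReal.ofReal ((h ^ (d + 2))⁻¹ / N) * ENNReal.ofReal M +
          ENNReal.ofReal ((h ^ (d + 2))⁻¹)⁻¹ *
            (ENNReal.ofReal ((h ^ d)⁻¹) * ENNReal.ofReal K)) := by gcongr
    _ = ENNReal.ofReal ((√d * h) ^ 2 + 2 * ((h ^ (d + 2))⁻¹ / N * M +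
          ((h ^ (d + 2))⁻¹)⁻¹ * ((h ^ d)⁻¹ * K))) := by
        rw [ENNReal.ofReal_add (by positivity) (by positivity),
          ENNReal.ofReal_mul (by norm_num : (0 : ℝ) ≤ 2),
          ENNReal.ofReal_add (by positivity) (by positivity),
          ENNReal.ofReal_mul (p := (h ^ (d + 2))⁻¹ / N) (by positivity),
          ENNReal.ofReal_mul (p := ((h ^ (d + 2))⁻¹)⁻¹) (by positivity),
          ENNReal.ofReal_mul (p := (h ^ d)⁻¹) (by positivity),
          ENNReal.ofReal_pow (by positivity), ENNReal.ofReal_ofNat]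
    _ = _ := by
        congr 1
        rw [Real.sq_sqrt hS.le, div_eq_mul_inv (d + 2 * (M + K)), ← hpow2, mul_pow,
          Real.sq_sqrt (Nat.cast_nonneg d)]
        have e1 : (h ^ (d + 2))⁻¹ / N = h ^ 2 := by
          rw [div_eq_iff hN0.ne']
          refine (eq_inv_of_mul_eq_one_left ?_).symm
          rw [← hpowN]; ring
        have e2 : ((h ^ (d + 2))⁻¹)⁻¹ * ((h ^ d)⁻¹ * K) = h ^ 2 * K := by
          rw [inv_inv]; field_simp; ring
        rw [e1, e2]
        ring
end
end

section
/- (Hewitt-Savage theorem.) Let Ω := (ℝ^d)^{ℕ*} be equipped with the product σ-algebra, and for each N > 1 and each permutation σ ∈ S_N define U_σ : Ω → Ω by U_σ(z_1, z_2, …) := (z_{σ(1)},…,z_{σ(N)}, z_{N+1}, z_{N+2}, …). Let P be a Borel probability measure on Ω such that U_σ#P = P for every N > 1 and every σ ∈ S_N. Then there exists a unique Borel probability measure π on the space of Borel probability measures on ℝ^d such that P = ∫ p^{⊗∞} π(dp), i.e. P is the mixture, with mixing measure π, of the infinite product measures p^{⊗∞}. -/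
open MeasureTheory Real Filter Topology
open scoped ENNReal NNReal

noncomputable section

theorem ENNReal.sq_dist_add_two_mul (u v : ℝ≥0∞) :
    ((u - v) + (v - u)) ^ 2 + 2 * (u * v) = u * u + v * v := by
  wlog h : u ≤ v generalizing u v
  · rw [add_comm (u - v), mul_comm u v, this v u (le_of_not_ge h), add_comm]
  obtain ⟨w, rfl⟩ := exists_add_of_le h
  rcases eq_or_ne u ∞ with rfl | hu
  · simp
  · rw [tsub_eq_zero_of_le h, ENNReal.add_sub_cancel_left hu]
    ring

/-- Equality case of the Cauchy-Schwarz inequality for `ℝ≥0∞`-valued functions of the same norm. -/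
theorem ae_eq_of_lintegral_mul_eq {α : Type*} [MeasurableSpace α] {μ : Measure α}
    {f g : α → ℝ≥0∞} (hf : Measurable f) (hg : Measurable g)
    (hfg : ∫⁻ a, f a * g a ∂μ = ∫⁻ a, g a * g a ∂μ)
    (hff : ∫⁻ a, f a * f a ∂μ = ∫⁻ a, g a * g a ∂μ)
    (hfin : ∫⁻ a, g a * g a ∂μ ≠ ∞) : f =ᵐ[μ] g := by
  have hD : Measurable fun a => (f a - g a + (g a - f a)) ^ 2 :=
    ((hf.sub hg).add (hg.sub hf)).pow_const 2
  have hsum : ∫⁻ a, (f a - g a + (g a - f a)) ^ 2 + 2 * (f a * g a) ∂μ =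
      ∫⁻ a, f a * f a + g a * g a ∂μ :=
    lintegral_congr fun a => ENNReal.sq_dist_add_two_mul _ _
  rw [lintegral_add_left hD, lintegral_add_left (f := fun a => f a * f a) (hf.mul hf),
    lintegral_const_mul (f := fun a => f a * g a) _ (hf.mul hg),
    hfg, hff, ← two_mul] at hsum
  have hzero : ∫⁻ a, (f a - g a + (g a - f a)) ^ 2 ∂μ = 0 :=
    (ENNReal.add_left_inj (ENNReal.mul_ne_top ENNReal.ofNat_ne_top hfin)).mp
      (hsum.trans (zero_add _).symm)
  filter_upwards [(lintegral_eq_zero_iff hD).mp hzero] with a ha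
  have ha' : f a ≤ g a ∧ g a ≤ f a := by simpa [tsub_eq_zero_iff_le] using ha
  exact le_antisymm ha'.1 ha'.2

section Exchangeable

open ProbabilityTheory

variable {E : Type*} [MeasurableSpace E]

/-- An exchangeable law on sequences is invariant under every injective reindexing. -/
theorem map_comp_injective_of_exchangeable {P : Measure (ℕ → E)} [IsProbabilityMeasure P]
    (hexch : ∀ N : ℕ, ∀ σ : Equiv.Perm (Fin N),
      Measure.map
        (fun z (n : ℕ) => if h : n < N then z (σ ⟨n, h⟩).val else z n) P = P)
    {φ : ℕ → ℕ} (hφ : Function.Injective φ) :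
    P.map (fun z n => z (φ n)) = P := by
  have hm : Measurable (fun (z : ℕ → E) n => z (φ n)) := by fun_prop
  refine IsProjectiveLimit.unique (P := fun J : Finset ℕ => P.map J.restrict) ?_ (fun _ => rfl)
  intro J
  rw [Measure.map_map (by fun_prop) hm]
  obtain ⟨N, hN⟩ : ∃ N, ∀ j ∈ J, j < N ∧ φ j < N := by
    refine ⟨J.sup id + J.sup φ + 1, fun j hj => ?_⟩
    have h1 : id j ≤ J.sup id := Finset.le_sup hj
    have h2 : φ j ≤ J.sup φ := Finset.le_sup hj
    simp only [id] at h1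
    omega
  obtain ⟨σ, hσ⟩ := Equiv.Perm.exists_extending_pair
    (fun j : J => (⟨j, (hN j j.2).1⟩ : Fin N)) (fun j : J => (⟨φ j, (hN j j.2).2⟩ : Fin N))
    (fun a b h => Subtype.ext (Fin.mk.inj_iff.mp h))
    (fun a b h => Subtype.ext (hφ (Fin.mk.inj_iff.mp h)))
  have hU : Measurable
      (fun (z : ℕ → E) (n : ℕ) => if h : n < N then z (σ ⟨n, h⟩).val else z n) := by
    refine measurable_pi_lambda _ fun n => ?_
    split_ifs <;> fun_prop
  change _ = P.map J.restrict
  conv_rhs => rw [← hexch N σ, Measure.map_map (by fun_prop) hU]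
  congr 1
  ext z j
  have := hσ j
  simp [(hN j j.2).1, this]

/-- A measurable family of probability measures has measurable finite powers. -/
theorem measurable_pi_const {α : Type*} [MeasurableSpace α] {p : α → Measure E}
    (hp : Measurable p) [∀ a, IsProbabilityMeasure (p a)] (n : ℕ) :
    Measurable fun a => Measure.pi (fun _ : Fin n => p a) := by
  refine Measurable.measure_of_isPiSystem_of_isProbabilityMeasure generateFrom_pi.symm
    isPiSystem_pi ?_
  rintro _ ⟨s, hs, rfl⟩
  simp only [Measure.pi_pi]
  exact Finset.measurable_prod _ fun i _ => (Measure.measurable_coe (hs i (Set.mem_univ i))).comp hp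

theorem aemeasurable_pi_const {m : Measure (Measure E)} [Nonempty E]
    (hm : ∀ᵐ p ∂m, IsProbabilityMeasure p) (n : ℕ)
    {s : Set (Fin n → E)} (hs : MeasurableSet s) :
    AEMeasurable (fun p => Measure.pi (fun _ : Fin n => p) s) m := by
  classical
  let q : Measure E → Measure E := fun p =>
    if p Set.univ = 1 then p else Measure.dirac (Classical.arbitrary E)
  have hq : Measurable q := Measurable.ite
    (Measure.measurable_coe MeasurableSet.univ (measurableSet_singleton 1)) measurable_id
    measurable_const
  have : ∀ p, IsProbabilityMeasure (q p) := by
    intro p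
    by_cases h : p Set.univ = 1
    · simpa [q, h] using ⟨h⟩
    · simp only [q, h, if_false]; infer_instance
  refine ⟨_, (Measure.measurable_coe hs).comp (measurable_pi_const hq n), ?_⟩
  filter_upwards [hm] with p hp
  simp [q, hp.measure_univ]

/-- A contractable law on sequences admits a directing kernel `κ`, which is almost surely
shift-invariant: `κ z` is the conditional law of a coordinate preceding `z`. -/
theorem exists_directing_kernel [StandardBorelSpace E] [Nonempty E]
    {P : Measure (ℕ → E)} [IsProbabilityMeasure P]
    (hshift : P.map (fun z n => z (n + 1)) = P)
    (hskip : P.map (fun z n => z (if n = 0 then 0 else n + 1)) = P) :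
    ∃ κ : Kernel (ℕ → E) E, IsMarkovKernel κ ∧
      (∀ F : (ℕ → E) → E → ℝ≥0∞, Measurable (Function.uncurry F) →
        ∫⁻ z, F (fun n => z (n + 1)) (z 0) ∂P = ∫⁻ z, ∫⁻ x, F z x ∂κ z ∂P) ∧
      ∀ B, MeasurableSet B → ∀ᵐ z ∂P, κ (fun n => z (n + 1)) B = κ z B := by
  set ρ : Measure ((ℕ → E) × E) := P.map (fun z => ((fun n => z (n + 1)), z 0)) with hρ
  have hmθ : Measurable (fun (z : ℕ → E) n => z (n + 1)) := by fun_prop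
  have hmρ : Measurable (fun (z : ℕ → E) => ((fun n => z (n + 1)), z 0)) := by fun_prop
  have : IsProbabilityMeasure ρ := Measure.isProbabilityMeasure_map hmρ.aemeasurable
  have hfst : ρ.fst = P := by
    rw [Measure.fst, hρ, Measure.map_map (by fun_prop) hmρ]
    exact hshift
  have hstat : ∀ f : (ℕ → E) → ℝ≥0∞, Measurable f →
      ∫⁻ z, f (fun n => z (n + 1)) ∂P = ∫⁻ z, f z ∂P := fun f hf => by
    conv_rhs => rw [← hshift, lintegral_map hf hmθ]
  have hdis : ∀ F : (ℕ → E) → E → ℝ≥0∞, Measurable (Function.uncurry F) →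
        ∫⁻ z, F (fun n => z (n + 1)) (z 0) ∂P = ∫⁻ z, ∫⁻ x, F z x ∂ρ.condKernel z ∂P := by
    intro F hF
    have h := Measure.lintegral_compProd (μ := ρ.fst) (κ := ρ.condKernel) hF
    rw [ρ.disintegrate ρ.condKernel, hfst] at h
    exact (lintegral_map hF hmρ).symm.trans h
  refine ⟨ρ.condKernel, inferInstance, hdis, fun B hB => ?_⟩
  set k : (ℕ → E) → ℝ≥0∞ := fun z => ρ.condKernel z B with hk
  have hkm : Measurable k := Kernel.measurable_coe _ hB
  have hk1 : ∀ z, k z ≤ 1 := fun z => prob_le_one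
  have hkθm : Measurable fun z : ℕ → E => k (fun n => z (n + 1)) := hkm.comp hmθ
  have hcross : ∫⁻ z, k (fun n => z (n + 1)) * k z ∂P = ∫⁻ z, k z * k z ∂P := by
    have hB1 : Measurable (B.indicator (1 : E → ℝ≥0∞)) := measurable_one.indicator hB
    have h1 := hdis (fun z x => k (fun n => z (n + 1)) * B.indicator 1 x)
      ((hkθm.comp measurable_fst).mul (hB1.comp measurable_snd))
    have h2 := hdis (fun z x => k z * B.indicator 1 x)
      ((hkm.comp measurable_fst).mul (hB1.comp measurable_snd))
    simp only [lintegral_const_mul _ hB1, lintegral_indicator_one hB] at h1 h2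
    refine h1.symm.trans (Eq.trans ?_ h2)
    have hG : Measurable fun z : ℕ → E => k (fun n => z (n + 1)) * B.indicator 1 (z 0) :=
      hkθm.mul (hB1.comp (measurable_pi_apply 0))
    conv_rhs => rw [← hskip, lintegral_map hG (by fun_prop)]
    simp
  have hle : ∫⁻ z, k z * k z ∂P ≤ 1 := by
    calc _ ≤ ∫⁻ _, 1 ∂P := lintegral_mono fun z => mul_le_one' (hk1 z) (hk1 z)
      _ = 1 := by simp
  exact ae_eq_of_lintegral_mul_eq hkθm hkm hcross (hstat (fun z => k z * k z) (hkm.mul hkm))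
    (hle.trans_lt ENNReal.one_lt_top).ne

/-- Given the invariant directing kernel, the coordinates are conditionally i.i.d. -/
theorem lintegral_prod_indicator_eq {P : Measure (ℕ → E)} [IsProbabilityMeasure P]
    (hshift : P.map (fun z n => z (n + 1)) = P) {κ : Kernel (ℕ → E) E}
    (hdis : ∀ F : (ℕ → E) → E → ℝ≥0∞, Measurable (Function.uncurry F) →
        ∫⁻ z, F (fun n => z (n + 1)) (z 0) ∂P = ∫⁻ z, ∫⁻ x, F z x ∂κ z ∂P)
    (hinv : ∀ B, MeasurableSet B → ∀ᵐ z ∂P, κ (fun n => z (n + 1)) B = κ z B)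
    (n : ℕ) (B : Fin n → Set E) (hB : ∀ i, MeasurableSet (B i))
    {g : (ℕ → E) → ℝ≥0∞} (hg : Measurable g) :
    ∫⁻ z, (∏ i : Fin n, (B i).indicator 1 (z i)) * g (fun k => z (k + n)) ∂P =
      ∫⁻ z, (∏ i : Fin n, κ z (B i)) * g z ∂P := by
  have hθ : MeasurePreserving (fun (z : ℕ → E) n => z (n + 1)) P P := ⟨by fun_prop, hshift⟩
  have hinv' : ∀ (m : ℕ) B, MeasurableSet B → ∀ᵐ z ∂P, κ (fun k => z (k + m)) B = κ z B := by
    intro m C hC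
    induction m with
    | zero => simp
    | succ m ih =>
      filter_upwards [hθ.quasiMeasurePreserving.ae ih, hinv C hC] with z h1 h2
      rw [← h2, ← h1]
      simp [add_assoc]
  induction n generalizing g with
  | zero => simp
  | succ n ih =>
    have hind : ∀ i, Measurable ((B i).indicator (1 : E → ℝ≥0∞)) := fun i =>
      measurable_one.indicator (hB i)
    have hG : Measurable fun z : ℕ → E =>
        (∏ i : Fin n, (B i.succ).indicator (1 : E → ℝ≥0∞) (z i)) * g (fun k => z (k + n)) :=
      (Finset.measurable_prod _ fun (i : Fin n) _ => (hind i.succ).comp (measurable_pi_apply (i : ℕ))).mul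
        (hg.comp (by fun_prop))
    have h0 : Measurable fun z => κ z (B 0) := Kernel.measurable_coe κ (hB 0)
    calc _ = ∫⁻ z, ∫⁻ x, ((∏ i : Fin n, (B i.succ).indicator 1 (z i)) * g (fun k => z (k + n))) *
            (B 0).indicator 1 x ∂κ z ∂P := by
          rw [← hdis (fun z x => ((∏ i : Fin n, (B i.succ).indicator 1 (z i)) *
            g (fun k => z (k + n))) * (B 0).indicator 1 x)
            ((hG.comp measurable_fst).mul ((hind 0).comp measurable_snd))]
          refine lintegral_congr fun z => ?_
          rw [Fin.prod_univ_succ]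
          simp only [Fin.val_zero, Fin.val_succ, add_assoc]
          ring
      _ = ∫⁻ z, (∏ i : Fin n, (B i.succ).indicator 1 (z i)) *
            (fun z => κ z (B 0) * g z) (fun k => z (k + n)) ∂P := by
          refine lintegral_congr_ae ?_
          filter_upwards [hinv' n _ (hB 0)] with z hz
          rw [lintegral_const_mul _ (hind 0), lintegral_indicator_one (hB 0), hz]
          ring
      _ = _ := by
          rw [ih (fun i => B i.succ) (fun i => hB _) (g := fun z => κ z (B 0) * g z) (h0.mul hg)]
          refine lintegral_congr fun z => ?_
          rw [Fin.prod_univ_succ]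
          ring

/-- Existence of the mixing measure in the Hewitt-Savage theorem. -/
theorem exists_mixing_measure [StandardBorelSpace E] [Nonempty E]
    {P : Measure (ℕ → E)} [IsProbabilityMeasure P]
    (hexch : ∀ N : ℕ, ∀ σ : Equiv.Perm (Fin N),
      Measure.map
        (fun z (n : ℕ) => if h : n < N then z (σ ⟨n, h⟩).val else z n) P = P) :
    ∃ mix : Measure (Measure E), IsProbabilityMeasure mix ∧
      ∀ (n : ℕ) (s : Set (Fin n → E)), MeasurableSet s →
        Measure.map (fun z (i : Fin n) => z i.val) P s =
          ∫⁻ p, Measure.pi (fun _ : Fin n => p) s ∂mix := by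
  have hshift := map_comp_injective_of_exchangeable hexch (φ := fun n => n + 1)
    (fun a b h => by simpa using h)
  obtain ⟨κ, hκ, hdis, hinv⟩ := exists_directing_kernel hshift
    (map_comp_injective_of_exchangeable hexch
      (φ := fun n => if n = 0 then 0 else n + 1) (fun a b h => by
        dsimp only at h; split_ifs at h <;> omega))
  have hprob : ∀ᵐ p ∂(P.map κ), IsProbabilityMeasure p := by
    have hS : MeasurableSet {p : Measure E | p Set.univ = 1} :=
      Measure.measurable_coe MeasurableSet.univ (measurableSet_singleton 1)
    have : ∀ᵐ p ∂(P.map κ), p Set.univ = 1 :=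
      (ae_map_iff κ.measurable.aemeasurable hS).mpr (by simp)
    filter_upwards [this] with p hp using ⟨hp⟩
  refine ⟨P.map κ, Measure.isProbabilityMeasure_map κ.measurable.aemeasurable,
    fun n s hs => ?_⟩
  have hmn : Measurable fun (z : ℕ → E) (i : Fin n) => z i.val := by fun_prop
  have hpi := measurable_pi_const κ.measurable n
  rw [lintegral_map' (aemeasurable_pi_const hprob n hs) κ.measurable.aemeasurable,
    ← Measure.bind_apply hs hpi.aemeasurable]
  congr 1
  have : IsProbabilityMeasure (P.map fun (z : ℕ → E) (i : Fin n) => z i.val) :=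
    Measure.isProbabilityMeasure_map hmn.aemeasurable
  refine ext_of_generate_finite _ generateFrom_pi.symm isPiSystem_pi ?_ ?_
  · rintro _ ⟨B, hB, rfl⟩
    have hB' : ∀ i, MeasurableSet (B i) := fun i => hB i (Set.mem_univ i)
    have hBm := MeasurableSet.univ_pi hB'
    have key := lintegral_prod_indicator_eq hshift hdis hinv n B hB' (g := 1) measurable_one
    rw [Measure.bind_apply hBm hpi.aemeasurable, Measure.map_apply hmn hBm]
    simp only [Measure.pi_pi]
    simp only [Pi.one_apply, mul_one] at key
    rw [← key, ← lintegral_indicator_one (hmn hBm)]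
    refine lintegral_congr fun z => ?_
    classical
    simp only [Set.indicator_apply, Set.mem_preimage, Set.mem_univ_pi, Pi.one_apply,
      Finset.prod_ite_zero]
    simp
  · rw [Measure.bind_apply MeasurableSet.univ hpi.aemeasurable]
    simp

end Exchangeable

section Moments

/-- Finite measures on a finite-dimensional cube are determined by their mixed moments. -/
theorem ext_of_moments_cube {J : Type*} [Fintype J] {μ ν : Measure (J → Set.Icc (0 : ℝ) 1)}
    [IsFiniteMeasure μ] [IsFiniteMeasure ν]
    (h : ∀ (n : ℕ) (c : Fin n → J),
      ∫ x, ∏ i, (x (c i) : ℝ) ∂μ = ∫ x, ∏ i, (x (c i) : ℝ) ∂ν) : μ = ν := by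
  let coord : J → BoundedContinuousFunction (J → Set.Icc (0 : ℝ) 1) ℝ := fun j =>
    BoundedContinuousFunction.mkOfCompact ⟨fun x => (x j : ℝ), by fun_prop⟩
  refine ext_of_forall_mem_subalgebra_integral_eq_of_polish (𝕜 := ℝ)
    (A := StarAlgebra.adjoin ℝ (Set.range coord)) ?_ ?_
  · intro x y hxy
    obtain ⟨j, hj⟩ := Function.ne_iff.mp hxy
    refine ⟨coord j, ⟨_, ⟨coord j, StarAlgebra.subset_adjoin ℝ _ ⟨j, rfl⟩, rfl⟩, rfl⟩, ?_⟩
    exact fun hc => hj (Subtype.ext hc)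
  · intro g hg
    have hstar : star (Set.range coord) = Set.range coord := by
      ext f
      rw [Set.mem_star, show star f = f from BoundedContinuousFunction.ext fun _ => rfl]
    have hg' : g ∈ Submodule.span ℝ
        (Submonoid.closure (Set.range coord) : Set (BoundedContinuousFunction _ ℝ)) := by
      have := StarAlgebra.adjoin_eq_span (R := ℝ) (Set.range coord)
      rw [hstar, Set.union_self] at this
      rw [← this]
      exact hg
    clear hg
    induction hg' using Submodule.span_induction with
    | mem f hf =>
      obtain ⟨l, hl, rfl⟩ := Submonoid.exists_list_of_mem_closure hf
      choose c hc using fun i : Fin l.length => hl _ (l.get_mem i)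
      have hval : ∀ x, l.prod x = ∏ i, (x (c i) : ℝ) := by
        intro x
        have h1 : l.prod = ∏ i, coord (c i) := by
          conv_lhs => rw [← List.ofFn_get l, List.prod_ofFn]
          exact Finset.prod_congr rfl fun i _ => (hc i).symm
        rw [h1, BoundedContinuousFunction.coe_prod, Finset.prod_apply]
        rfl
      simp only [hval]
      exact h _ _
    | zero => simp
    | add f g _ _ hf hg =>
      simp only [BoundedContinuousFunction.coe_add, Pi.add_apply]
      rw [integral_add (f.integrable μ) (g.integrable μ),
        integral_add (f.integrable ν) (g.integrable ν), hf, hg]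
    | smul a f _ hf =>
      simp only [BoundedContinuousFunction.coe_smul, integral_smul, hf]

end Moments

section Uniqueness

variable {E : Type*} [MeasurableSpace E]

theorem measure_univ_le_pi_fin_one (p : Measure E) :
    p Set.univ ≤ Measure.pi (fun _ : Fin 1 => p) Set.univ := by
  let e : E ≃ᵐ (Fin 1 → E) := (MeasurableEquiv.funUnique (Fin 1) E).symm
  have hle : (p.map e).toOuterMeasure ≤
      OuterMeasure.pi (fun _ : Fin 1 => p.toOuterMeasure) := by
    rw [OuterMeasure.le_pi]
    intro s _
    rw [Measure.coe_toOuterMeasure, e.map_apply, Fin.prod_univ_one]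
    refine measure_mono fun x hx => ?_
    exact hx 0 (Set.mem_univ 0)
  rw [Measure.pi, toMeasure_apply _ _ MeasurableSet.univ]
  refine le_trans (le_of_eq ?_) (hle Set.univ)
  rw [Measure.coe_toOuterMeasure, e.map_apply, Set.preimage_univ]

/-- If the one- and two-fold product mixtures have total mass one, almost every component is a
probability measure. -/
theorem ae_isProbabilityMeasure_of_lintegral_pi {m : Measure (Measure E)} [IsProbabilityMeasure m]
    (h : ∀ n, ∫⁻ p, Measure.pi (fun _ : Fin n => p) Set.univ ∂m = 1) :
    ∀ᵐ p ∂m, IsProbabilityMeasure p := by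
  have hmeas : Measurable fun p : Measure E => p Set.univ :=
    Measure.measurable_coe MeasurableSet.univ
  have hlt : ∀ᵐ p ∂m, p Set.univ < ∞ := by
    refine ae_lt_top hmeas (ne_of_lt ?_)
    calc _ ≤ _ := lintegral_mono measure_univ_le_pi_fin_one
      _ < ∞ := by rw [h 1]; exact ENNReal.one_lt_top
  have hpow : ∀ n, ∫⁻ p, p Set.univ ^ n ∂m = 1 := by
    intro n
    rw [← h n]
    refine lintegral_congr_ae ?_
    filter_upwards [hlt] with p hp
    have : IsFiniteMeasure p := ⟨hp⟩
    simp [Measure.pi_univ]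
  have h1 := hpow 1
  have h2 := hpow 2
  simp only [pow_one, pow_two] at h1 h2
  have := ae_eq_of_lintegral_mul_eq (μ := m) hmeas (measurable_const (a := 1))
    (by simpa using h1) (by simpa using h2) (by simp)
  filter_upwards [this] with p hp using ⟨hp⟩

/-- A law on probability measures is determined by its mixtures of products on boxes. -/
theorem ext_of_lintegral_prod_eq {m₁ m₂ : Measure (Measure E)}
    [IsProbabilityMeasure m₁] [IsProbabilityMeasure m₂]
    (h₁ : ∀ᵐ p ∂m₁, IsProbabilityMeasure p) (h₂ : ∀ᵐ p ∂m₂, IsProbabilityMeasure p)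
    (h : ∀ (n : ℕ) (B : Fin n → Set E), (∀ i, MeasurableSet (B i)) →
      ∫⁻ p, ∏ i, p (B i) ∂m₁ = ∫⁻ p, ∏ i, p (B i) ∂m₂) : m₁ = m₂ := by
  let I := {B : Set E // MeasurableSet B}
  have hev : ∀ B : I, Measurable fun p : Measure E => p B.1 := fun B => Measure.measurable_coe B.2
  let Φ : Measure E → I → ℝ≥0∞ := fun p B => p B.1
  have hΦ : Measurable Φ := measurable_pi_lambda _ hev
  let Ψ (J : Finset I) : Measure E → J → Set.Icc (0 : ℝ) 1 := fun p j =>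
    Set.projIcc 0 1 zero_le_one (p j.1.1).toReal
  have hΨ : ∀ J, Measurable (Ψ J) := fun J => measurable_pi_lambda _ fun j =>
    continuous_projIcc.measurable.comp (hev j.1).ennreal_toReal
  have hΨval : ∀ (J : Finset I) (p : Measure E) [IsProbabilityMeasure p] (j : J),
      (Ψ J p j : ℝ) = (p j.1.1).toReal := fun J p _ j => by
    have : (p j.1.1).toReal ≤ 1 := measureReal_le_one
    simp [Ψ, Set.projIcc, this]
  have hmom : ∀ (m : Measure (Measure E)), (∀ᵐ p ∂m, IsProbabilityMeasure p) →
      ∀ (J : Finset I) (n : ℕ) (c : Fin n → J),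
      ∫ x, ∏ i, (x (c i) : ℝ) ∂(m.map (Ψ J)) = (∫⁻ p, ∏ i, p (c i).1.1 ∂m).toReal := by
    intro m hm J n c
    rw [integral_map (hΨ J).aemeasurable
      (Continuous.aestronglyMeasurable (by fun_prop)), ← integral_toReal]
    · refine integral_congr_ae ?_
      filter_upwards [hm] with p hp
      simp [hΨval, ENNReal.toReal_prod]
    · exact (Finset.measurable_prod _ fun i _ => hev _).aemeasurable
    · filter_upwards [hm] with p hp
      exact ENNReal.prod_lt_top fun i _ => measure_lt_top _ _
  have hJ : ∀ J, m₁.map (Ψ J) = m₂.map (Ψ J) := by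
    intro J
    have := Measure.isProbabilityMeasure_map (μ := m₁) (hΨ J).aemeasurable
    have := Measure.isProbabilityMeasure_map (μ := m₂) (hΨ J).aemeasurable
    refine ext_of_moments_cube fun n c => ?_
    rw [hmom m₁ h₁, hmom m₂ h₂, h n _ fun i => (c i).1.2]
  have hfin : ∀ (m : Measure (Measure E)), (∀ᵐ p ∂m, IsProbabilityMeasure p) →
      ∀ J : Finset I, (m.map Φ).map J.restrict =
        (m.map (Ψ J)).map fun x j => ENNReal.ofReal (x j) := by
    intro m hm J
    rw [Measure.map_map (by fun_prop) hΦ, Measure.map_map (by fun_prop) (hΨ J)]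
    refine Measure.map_congr ?_
    filter_upwards [hm] with p hp
    ext j
    simp [hΨval, Φ]
  have := Measure.isProbabilityMeasure_map (μ := m₁) hΦ.aemeasurable
  have hmap : m₁.map Φ = m₂.map Φ :=
    IsProjectiveLimit.unique (P := fun J : Finset I => (m₁.map Φ).map J.restrict) (fun _ => rfl)
      fun J => by rw [hfin m₂ h₂, ← hJ, ← hfin m₁ h₁]
  have hcomap : (Measure.instMeasurableSpace : MeasurableSpace (Measure E)) ≤
      MeasurableSpace.comap Φ MeasurableSpace.pi := by
    refine iSup₂_le fun s hs => ?_
    rintro _ ⟨t, ht, rfl⟩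
    exact ⟨(fun x : I → ℝ≥0∞ => x ⟨s, hs⟩) ⁻¹' t, measurable_pi_apply _ ht, rfl⟩
  ext A hA
  obtain ⟨T, hT, rfl⟩ := hcomap A hA
  rw [← Measure.map_apply hΦ hT, ← Measure.map_apply hΦ hT, hmap]

end Uniqueness

/-- Hewitt-Savage theorem: if `P` is a Borel probability measure
on `Ω = (ℝ^d)^{ℕ*}` invariant under every permutation of finitely many
coordinates, then there is a unique Borel probability measure `π` on the space
of Borel probability measures on `ℝ^d` such that `P = ∫ p^{⊗∞} π(dp)`, i.e.
every finite-dimensional marginal of `P` is the corresponding mixture of finite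
product measures. -/
theorem stmt18 (d : ℕ) (P : Measure (ℕ → EuclideanSpace ℝ (Fin d)))
    [IsProbabilityMeasure P]
    (hexch : ∀ N : ℕ, ∀ σ : Equiv.Perm (Fin N),
      Measure.map
        (fun z (n : ℕ) => if h : n < N then z (σ ⟨n, h⟩).val else z n) P = P) :
    ∃! mix : Measure (Measure (EuclideanSpace ℝ (Fin d))),
      IsProbabilityMeasure mix ∧
      ∀ (n : ℕ) (s : Set (Fin n → EuclideanSpace ℝ (Fin d))), MeasurableSet s →
        Measure.map (fun z (i : Fin n) => z i.val) P s =
          ∫⁻ p, Measure.pi (fun _ : Fin n => p) s ∂mix := by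
  obtain ⟨mix, hmix, hrep⟩ := exists_mixing_measure hexch
  refine ⟨mix, ⟨hmix, hrep⟩, ?_⟩
  rintro mix' ⟨hmix', hrep'⟩
  have hprob : ∀ m : Measure (Measure (EuclideanSpace ℝ (Fin d))), IsProbabilityMeasure m →
      (∀ (n : ℕ) (s : Set (Fin n → EuclideanSpace ℝ (Fin d))), MeasurableSet s →
        Measure.map (fun z (i : Fin n) => z i.val) P s =
          ∫⁻ p, Measure.pi (fun _ : Fin n => p) s ∂m) →
      ∀ᵐ p ∂m, IsProbabilityMeasure p := by
    intro m hm h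
    refine ae_isProbabilityMeasure_of_lintegral_pi fun n => ?_
    rw [← h n _ MeasurableSet.univ, Measure.map_apply (by fun_prop) MeasurableSet.univ]
    simp
  have hbox : ∀ m : Measure (Measure (EuclideanSpace ℝ (Fin d))),
      (∀ᵐ p ∂m, IsProbabilityMeasure p) →
      ∀ (n : ℕ) (B : Fin n → Set (EuclideanSpace ℝ (Fin d))),
        ∫⁻ p, ∏ i, p (B i) ∂m = ∫⁻ p, Measure.pi (fun _ : Fin n => p) (Set.univ.pi B) ∂m := by
    intro m hm n B
    refine lintegral_congr_ae ?_
    filter_upwards [hm] with p hp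
    rw [Measure.pi_pi]
  have h := hprob mix hmix hrep
  have h' := hprob mix' hmix' hrep'
  refine ext_of_lintegral_prod_eq h' h fun n B hB => ?_
  rw [hbox mix h, hbox mix' h', ← hrep n _ (MeasurableSet.univ_pi hB),
    ← hrep' n _ (MeasurableSet.univ_pi hB)]
end
end
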